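/- arXiv:1405.0322 — 6 statements merged into one kernel-verified Lean document; each statement's English description precedes it below -/
import Mathlib

section
/- Let C ⊆ ℝⁿ be a polyhedral convex set, i.e., C = {x ∈ ℝⁿ : bᵢᵀx ≤ γᵢ for i = 1,…,K} for finitely many vectors bᵢ ∈ ℝⁿ and scalars γᵢ ∈ ℝ. Then the dual cone C* = {p ∈ ℝⁿ : pᵀt ≥ 0 for all t ∈ C} is a closed convex polyhedral cone; that is, C* is a closed convex cone and there exist finitely many vectors a₁,…,a_L ∈ ℝⁿ such that C* = {p ∈ ℝⁿ : aⱼᵀp ≤ 0 for j = 1,…,L}. -/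
open Matrix

open scoped NNReal in
lemma dc_fin_real : Module.Finite ℝ≥0 ℝ := by
  refine ⟨⟨{1, -1}, ?_⟩⟩
  rw [eq_top_iff]
  intro x _
  rcases le_total 0 x with h | h
  · have : x = (⟨x, h⟩ : ℝ≥0) • (1 : ℝ) := by simp [NNReal.smul_def]
    rw [this]
    exact Submodule.smul_mem _ _ (Submodule.subset_span (by simp))
  · have : x = (⟨-x, by linarith⟩ : ℝ≥0) • (-1 : ℝ) := by simp [NNReal.smul_def]
    rw [this]
    exact Submodule.smul_mem _ _ (Submodule.subset_span (by simp))

open scoped NNReal in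
lemma dc_smul {E : Type*} [AddCommGroup E] [Module ℝ E] (M : Submodule ℝ≥0 E) {r : ℝ} (hr : 0 ≤ r)
    {x : E} (hx : x ∈ M) : r • x ∈ M := M.smul_mem (⟨r, hr⟩ : ℝ≥0) hx

open scoped NNReal in
lemma dc_step {E : Type*} [AddCommGroup E] [Module ℝ E] (S : Set E) (hS : S.Finite)
    (φ : E →ₗ[ℝ] ℝ) : ∃ T : Set E, T.Finite ∧
      ∀ x, x ∈ Submodule.span ℝ≥0 T ↔ x ∈ Submodule.span ℝ≥0 S ∧ φ x ≤ 0 := by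
  set P := {g ∈ S | 0 < φ g} with hP
  set N := {g ∈ S | φ g ≤ 0} with hN
  have hPf : P.Finite := hS.subset (Set.sep_subset _ _)
  have hNf : N.Finite := hS.subset (Set.sep_subset _ _)
  set T := N ∪ Set.image2 (fun g h => φ g • h - φ h • g) P N with hT
  have hSPN : S = P ∪ N := by
    ext x; simp only [hP, hN, Set.mem_union, Set.mem_setOf_eq]
    rcases lt_or_ge 0 (φ x) with h | h <;> simp [h, not_le.2, not_lt.2]
  refine ⟨T, hNf.union (hPf.image2 _ hNf), fun x => ⟨fun hx => ?_, ?_⟩⟩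
  · induction hx using Submodule.span_induction with
    | mem x hx =>
      rcases hx with hx | ⟨g, hg, h, hh, rfl⟩
      · exact ⟨Submodule.subset_span hx.1, hx.2⟩
      · constructor
        · have h1 := dc_smul _ hg.2.le (Submodule.subset_span (R := ℝ≥0) hh.1)
          have h2 := dc_smul _ (neg_nonneg.2 hh.2) (Submodule.subset_span (R := ℝ≥0) hg.1)
          have := add_mem h1 h2
          rwa [neg_smul, ← sub_eq_add_neg] at this
        · simp [mul_comm]
    | zero => simp
    | add x y _ _ hx hy => exact ⟨add_mem hx.1 hy.1, by rw [map_add]; linarith [hx.2, hy.2]⟩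
    | smul r x _ hx =>
      refine ⟨Submodule.smul_mem _ _ hx.1, ?_⟩
      rw [NNReal.smul_def, map_smul]
      exact mul_nonpos_of_nonneg_of_nonpos r.2 hx.2
  · rintro ⟨hx, hφ⟩
    rw [hSPN, Submodule.span_union, Submodule.mem_sup] at hx
    obtain ⟨y, hy, z, hz, rfl⟩ := hx
    have hzT : z ∈ Submodule.span ℝ≥0 T := Submodule.span_mono Set.subset_union_left hz
    have hz0 : φ z ≤ 0 := by
      clear hzT hφ
      induction hz using Submodule.span_induction with
      | mem x hx => exact hx.2
      | zero => simp
      | add x y _ _ hx hy => rw [map_add]; linarith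
      | smul r x _ hx =>
        rw [NNReal.smul_def, map_smul]
        exact mul_nonpos_of_nonneg_of_nonpos r.2 hx
    have hy0 : y = 0 ∨ 0 < φ y := by
      clear hφ
      induction hy using Submodule.span_induction with
      | mem x hx => exact Or.inr hx.2
      | zero => simp
      | add x y _ _ hx hy =>
        rcases hx with rfl | hx
        · simpa using hy
        · rcases hy with rfl | hy
          · simpa using Or.inr hx
          · right; rw [map_add]; linarith
      | smul r x _ hx =>
        rcases hx with rfl | hx
        · simp
        · rcases eq_or_ne r 0 with rfl | hr
          · simp
          · right
            rw [NNReal.smul_def, map_smul]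
            exact mul_pos (by positivity) hx
    have key : φ y • z - φ z • y ∈ Submodule.span ℝ≥0 T := by
      clear hφ hy0 hz0 hzT
      induction hy using Submodule.span_induction with
      | mem g hg =>
        induction hz using Submodule.span_induction with
        | mem h hh => exact Submodule.subset_span (Or.inr ⟨g, hg, h, hh, rfl⟩)
        | zero => simp
        | add a b _ _ ha hb =>
          convert add_mem ha hb using 1
          rw [map_add]; module
        | smul r a _ ha =>
          convert Submodule.smul_mem _ r ha using 1
          simp only [NNReal.smul_def, map_smul, smul_eq_mul]; module
      | zero => simp
      | add a b _ _ ha hb =>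
        convert add_mem ha hb using 1
        rw [map_add]; module
      | smul r a _ ha =>
        convert Submodule.smul_mem _ r ha using 1
        simp only [NNReal.smul_def, map_smul, smul_eq_mul]; module
    rw [map_add] at hφ
    rcases hy0 with rfl | hy0
    · simpa using hzT
    · have hzn : 0 < -φ z := by linarith
      have h1 := add_mem key (dc_smul _ (show 0 ≤ -φ z - φ y by linarith) hzT)
      have h2 := dc_smul _ (inv_nonneg.2 hzn.le) h1
      have h3 : φ y • z - φ z • y + (-φ z - φ y) • z = (-φ z) • (y + z) := by module
      rwa [h3, smul_smul, inv_mul_cancel₀ hzn.ne', one_smul] at h2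

open scoped NNReal in
lemma dc_hcone {E : Type*} [AddCommGroup E] [Module ℝ E] [Module.Finite ℝ E]
    (l : List (E →ₗ[ℝ] ℝ)) : ∃ T : Set E, T.Finite ∧
      ∀ x, x ∈ Submodule.span ℝ≥0 T ↔ ∀ φ ∈ l, φ x ≤ 0 := by
  induction l with
  | nil =>
    haveI := dc_fin_real
    haveI : Module.Finite ℝ≥0 E := Module.Finite.trans ℝ E
    obtain ⟨s, hs⟩ := (Module.Finite.fg_top : (⊤ : Submodule ℝ≥0 E).FG)
    exact ⟨s, s.finite_toSet, by simp [hs]⟩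
  | cons φ l ih =>
    obtain ⟨S, hS, h⟩ := ih
    obtain ⟨T, hT, h'⟩ := dc_step S hS φ
    refine ⟨T, hT, fun x => ?_⟩
    rw [h', h, List.forall_mem_cons, and_comm]

/-- The dual cone of a polyhedral convex set is a closed convex polyhedral cone. -/
theorem dual_cone_of_polyhedral_is_closed_convex_polyhedral_cone
    (n K : ℕ) (b : Fin K → (Fin n → ℝ)) (γ : Fin K → ℝ)
    (C : Set (Fin n → ℝ)) (hC : C = {x | ∀ i, b i ⬝ᵥ x ≤ γ i}) :
    IsClosed {p : Fin n → ℝ | ∀ t ∈ C, 0 ≤ p ⬝ᵥ t} ∧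
    Convex ℝ {p : Fin n → ℝ | ∀ t ∈ C, 0 ≤ p ⬝ᵥ t} ∧
    (∀ (r : ℝ), 0 ≤ r → ∀ p ∈ {p : Fin n → ℝ | ∀ t ∈ C, 0 ≤ p ⬝ᵥ t},
      r • p ∈ {p : Fin n → ℝ | ∀ t ∈ C, 0 ≤ p ⬝ᵥ t}) ∧
    (∃ (L : ℕ) (a : Fin L → (Fin n → ℝ)),
      {p : Fin n → ℝ | ∀ t ∈ C, 0 ≤ p ⬝ᵥ t} = {p | ∀ j, a j ⬝ᵥ p ≤ 0}) := by
  refine ⟨?_, ?_, ?_, ?_⟩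
  · simp only [Set.setOf_forall]
    refine isClosed_iInter fun t => isClosed_iInter fun _ => ?_
    exact isClosed_le continuous_const (by unfold dotProduct; fun_prop)
  · intro p hp q hq u v hu hv _ t ht
    rw [add_dotProduct, smul_dotProduct, smul_dotProduct]
    exact add_nonneg (mul_nonneg hu (hp t ht)) (mul_nonneg hv (hq t ht))
  · intro r hr p hp t ht
    rw [smul_dotProduct]
    exact mul_nonneg hr (hp t ht)
  · rcases C.eq_empty_or_nonempty with he | ⟨t₀, ht₀⟩
    · exact ⟨0, fun _ => 0, by simp [he]⟩
    let D : (Fin n → ℝ) → ((Fin n → ℝ) →ₗ[ℝ] ℝ) := fun v => dotProductBilin ℝ ℝ v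
    have hD : ∀ v x, D v x = v ⬝ᵥ x := fun v x => rfl
    let f : Fin K → (((Fin n → ℝ) × ℝ) →ₗ[ℝ] ℝ) := fun i =>
      (D (b i)).comp (LinearMap.fst ℝ _ _) - γ i • LinearMap.snd ℝ _ _
    obtain ⟨T, hT, h⟩ := dc_hcone ((-LinearMap.snd ℝ (Fin n → ℝ) ℝ) :: List.ofFn f)
    have h' : ∀ x s, (x, s) ∈ Submodule.span NNReal T ↔
        0 ≤ s ∧ ∀ i, b i ⬝ᵥ x ≤ γ i * s := by
      intro x s
      rw [h]
      simp [List.mem_ofFn, f, hD]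
    obtain ⟨L, e, he⟩ : ∃ (L : ℕ) (e : Fin L → (Fin n → ℝ) × ℝ), Set.range e = T := by
      haveI := hT.fintype
      refine ⟨Fintype.card T, fun i => ((Fintype.equivFin T).symm i : _), ?_⟩
      rw [← Function.comp_def, Set.range_comp]
      simp
    refine ⟨L, fun j => -(e j).1, ?_⟩
    subst hC
    ext p
    simp only [Set.mem_setOf_eq, neg_dotProduct, neg_nonpos]
    constructor
    · intro hp j
      have hj : e j ∈ Submodule.span NNReal T := Submodule.subset_span (he ▸ ⟨j, rfl⟩)
      generalize e j = w at hj ⊢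
      obtain ⟨x, s⟩ := w
      obtain ⟨hs, hx⟩ := (h' x s).1 hj
      rw [dotProduct_comm]
      change 0 ≤ p ⬝ᵥ x
      rcases hs.eq_or_lt with rfl | hs
      · by_contra! hneg
        have hmem : ∀ r : ℝ, 0 ≤ r → 0 ≤ p ⬝ᵥ t₀ + r * (p ⬝ᵥ x) := by
          intro r hr
          have := hp (t₀ + r • x) (fun i => by
            have h1 := ht₀ i
            have h2 := hx i
            rw [dotProduct_add, dotProduct_smul, smul_eq_mul]
            nlinarith)
          rwa [dotProduct_add, dotProduct_smul, smul_eq_mul] at this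
        have h0 := hp t₀ ht₀
        have := hmem ((p ⬝ᵥ t₀ + 1) / (-(p ⬝ᵥ x))) (div_nonneg (by linarith) (by linarith))
        have e1 : (p ⬝ᵥ t₀ + 1) / (-(p ⬝ᵥ x)) * (p ⬝ᵥ x) = -(p ⬝ᵥ t₀ + 1) := by
          have := hneg.ne
          field_simp
        linarith
      · have := hp (s⁻¹ • x) (fun i => by
          rw [dotProduct_smul, smul_eq_mul, inv_mul_le_iff₀ hs, mul_comm]
          exact hx i)
        rw [dotProduct_smul, smul_eq_mul] at this
        exact nonneg_of_mul_nonneg_right this (inv_pos.2 hs)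
    · intro hp t ht
      have hm : (t, (1 : ℝ)) ∈ Submodule.span NNReal T := (h' t 1).2 ⟨zero_le_one, by simpa using ht⟩
      have : ∀ z ∈ Submodule.span NNReal T, 0 ≤ p ⬝ᵥ z.1 := by
        intro z hz
        induction hz using Submodule.span_induction with
        | mem z hz =>
          rw [← he] at hz
          obtain ⟨j, rfl⟩ := hz
          rw [dotProduct_comm]; exact hp j
        | zero => simp
        | add x y _ _ hx hy => rw [Prod.fst_add, dotProduct_add]; exact add_nonneg hx hy
        | smul r x _ hx =>
          rw [NNReal.smul_def, Prod.smul_fst, dotProduct_smul]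
          exact mul_nonneg r.2 hx
      exact this _ hm
end

section
/- Let C ⊆ ℝⁿ be a nonempty closed convex polyhedron (a finite intersection of closed halfspaces) and let D ⊆ ℝⁿ be a nonempty closed convex polyhedral cone. If for every d ∈ D there exists c ∈ C such that cᵀd ≥ 0, then there exists c' ∈ C such that (c')ᵀd ≥ 0 for all d ∈ D. -/
open Matrix

lemma bartl_farkas {V ι : Type*} [AddCommGroup V] [Module ℝ V] (s : Finset ι) :
    ∀ (A : ι → V →ₗ[ℝ] ℝ) (g : V →ₗ[ℝ] ℝ),
      (∀ x, (∀ j ∈ s, 0 ≤ A j x) → 0 ≤ g x) →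
      ∃ l : ι → ℝ, (∀ j, 0 ≤ l j) ∧ ∀ x, g x = ∑ j ∈ s, l j * A j x := by
  classical
  induction s using Finset.induction_on with
  | empty =>
    intro A g h
    refine ⟨0, fun _ => le_rfl, fun x => ?_⟩
    have h1 := h x (by simp)
    have h2 := h (-x) (by simp)
    rw [map_neg] at h2
    simp only [Finset.sum_empty]
    linarith
  | insert k s hk ih =>
    intro A g h
    by_cases hb : ∀ x, (∀ j ∈ s, 0 ≤ A j x) → 0 ≤ g x
    · obtain ⟨l, hl, hg⟩ := ih A g hb
      refine ⟨fun j => if j = k then 0 else l j, fun j => ?_, fun x => ?_⟩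
      · dsimp only
        split_ifs
        · exact le_rfl
        · exact hl j
      · rw [Finset.sum_insert hk, hg x]
        simp only [if_true, zero_mul, zero_add]
        refine Finset.sum_congr rfl fun j hj => ?_
        have hne : j ≠ k := fun e => hk (e ▸ hj)
        simp only [if_neg hne]
    · push Not at hb
      obtain ⟨x1, hx1, hgx1⟩ := hb
      have hkx1 : A k x1 < 0 := by
        by_contra hc
        push Not at hc
        have := h x1 (by
          intro j hj
          rcases Finset.mem_insert.1 hj with rfl | hj
          · exact hc
          · exact hx1 j hj)
        linarith
      obtain ⟨x0, hx0, hgx0, hkx0⟩ : ∃ x0, (∀ j ∈ s, 0 ≤ A j x0) ∧ g x0 < 0 ∧ A k x0 = -1 := by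
        have hp : 0 < (-(A k x1))⁻¹ := inv_pos.2 (by linarith)
        refine ⟨(-(A k x1))⁻¹ • x1, fun j hj => ?_, ?_, ?_⟩
        · rw [map_smul, smul_eq_mul]
          exact mul_nonneg hp.le (hx1 j hj)
        · rw [map_smul, smul_eq_mul]
          exact mul_neg_of_pos_of_neg hp hgx1
        · rw [map_smul, smul_eq_mul]
          have := hkx1.ne
          field_simp
      obtain ⟨l, hl, hg⟩ := ih (fun j => A j + (A j x0) • A k) (g + (g x0) • A k) (by
        intro x hx
        have := h (x + A k x • x0) (by
          intro j hj
          rcases Finset.mem_insert.1 hj with rfl | hj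
          · simp [hkx0]
          · have := hx j hj
            simp only [LinearMap.add_apply, LinearMap.smul_apply, smul_eq_mul] at this
            simp only [map_add, map_smul, smul_eq_mul]
            linarith)
        simp only [map_add, map_smul, smul_eq_mul] at this
        simp only [LinearMap.add_apply, LinearMap.smul_apply, smul_eq_mul]
        linarith)
      have hS : 0 ≤ ∑ j ∈ s, l j * A j x0 :=
        Finset.sum_nonneg fun j hj => mul_nonneg (hl j) (hx0 j hj)
      refine ⟨fun j => if j = k then ∑ j ∈ s, l j * A j x0 - g x0 else l j,
        fun j => ?_, fun x => ?_⟩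
      · dsimp only
        split_ifs
        · linarith
        · exact hl j
      · rw [Finset.sum_insert hk]
        have e : ∑ j ∈ s, (if j = k then ∑ j ∈ s, l j * A j x0 - g x0 else l j) * A j x
            = ∑ j ∈ s, l j * A j x := by
          refine Finset.sum_congr rfl fun j hj => ?_
          have hne : j ≠ k := fun e => hk (e ▸ hj)
          simp only [if_neg hne]
        have := hg x
        simp only [LinearMap.add_apply, LinearMap.smul_apply, smul_eq_mul, mul_add,
          Finset.sum_add_distrib, ← mul_assoc, ← Finset.sum_mul] at this
        dsimp only
        rw [e, if_pos rfl]
        linarith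

/-- If a nonempty closed convex polyhedron `C` is such that for every `d` in a nonempty
closed convex polyhedral cone `D` there is `c ∈ C` with `cᵀd ≥ 0`, then a single `c' ∈ C`
works for all `d ∈ D`. -/
theorem exists_common_nonneg_inner_vector
    (n K L : ℕ) (b : Fin K → (Fin n → ℝ)) (γ : Fin K → ℝ)
    (a : Fin L → (Fin n → ℝ))
    (C D : Set (Fin n → ℝ))
    (hC : C = {x | ∀ i, b i ⬝ᵥ x ≤ γ i}) (hCne : C.Nonempty)
    (hD : D = {x | ∀ j, a j ⬝ᵥ x ≤ 0}) (hDne : D.Nonempty)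
    (h : ∀ d ∈ D, ∃ c ∈ C, 0 ≤ c ⬝ᵥ d) :
    ∃ c' ∈ C, ∀ d ∈ D, 0 ≤ c' ⬝ᵥ d := by
  classical
  subst hC hD
  let A : Fin K ⊕ Fin L → (Fin K → ℝ) →ₗ[ℝ] ℝ := Sum.elim
    (fun i => LinearMap.proj i)
    (fun j => ∑ i, (-(a j ⬝ᵥ b i)) • LinearMap.proj i)
  let g : (Fin K → ℝ) →ₗ[ℝ] ℝ := ∑ i, γ i • LinearMap.proj i
  have hA1 : ∀ i y, A (Sum.inl i) y = y i := fun i y => rfl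
  have hA2 : ∀ j y, A (Sum.inr j) y = ∑ i, -(a j ⬝ᵥ b i) * y i := fun j y => by
    simp [A, LinearMap.sum_apply]
  have hg0 : ∀ y, g y = ∑ i, γ i * y i := fun y => by
    simp [g, LinearMap.sum_apply]
  obtain ⟨l, hl, hg⟩ := bartl_farkas Finset.univ A g (by
    intro y hy
    have hy1 : ∀ i, 0 ≤ y i := fun i => hy (Sum.inl i) (Finset.mem_univ _)
    obtain ⟨c, hc, hcd⟩ := h (∑ i, y i • b i) (by
      intro j
      have := hy (Sum.inr j) (Finset.mem_univ _)
      rw [hA2] at this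
      simp only [neg_mul, Finset.sum_neg_distrib] at this
      rw [dotProduct_sum]
      simp only [dotProduct_smul, smul_eq_mul]
      simp only [mul_comm (a j ⬝ᵥ b _)] at this
      linarith)
    rw [dotProduct_sum] at hcd
    simp only [dotProduct_smul, smul_eq_mul] at hcd
    rw [hg0]
    refine hcd.trans (Finset.sum_le_sum fun i _ => ?_)
    rw [mul_comm, dotProduct_comm]
    exact mul_le_mul_of_nonneg_right (hc i) (hy1 i))
  refine ⟨-∑ j, l (Sum.inr j) • a j, fun i => ?_, fun d hd => ?_⟩
  · have := hg (Pi.single i 1)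
    rw [hg0, Fintype.sum_sum_type] at this
    simp only [hA1, hA2, Pi.single_apply, mul_ite, mul_one, mul_zero, Finset.sum_ite_eq,
      Finset.sum_ite_eq', Finset.mem_univ, if_true] at this
    rw [dotProduct_neg, dotProduct_sum]
    simp only [dotProduct_comm (b i), smul_dotProduct, smul_eq_mul]
    simp only [mul_neg, Finset.sum_neg_distrib] at this
    have := hl (Sum.inl i)
    linarith
  · rw [neg_dotProduct, sum_dotProduct, ← Finset.sum_neg_distrib]
    refine Finset.sum_nonneg fun j _ => ?_
    rw [smul_dotProduct, smul_eq_mul]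
    have := mul_nonneg (hl (Sum.inr j)) (neg_nonneg.2 (hd j))
    linarith
end

section
/- Consider the problem of minimizing φ(x) = pᵀx + h(c(x)) over a nonempty polyhedral convex set Ω ⊆ ℝⁿ, where c : ℝⁿ → ℝᵐ is continuously differentiable and h : ℝᵐ → ℝ is polyhedral convex, h(c) = max_{j=1,…,M}(hⱼᵀc + βⱼ). Fix parameters 0 < ρ̲ < η̲ < 0.5 < η̄ < 1, 0 < c₂ < 1 < c₁, Δ̄ > 0, and let x⁰ ∈ Ω, Δ⁰ ∈ (0, Δ̄]. Suppose the sequences {x^k}, {d^k}, {Δ^k} are generated as follows: d^k is a global minimizer of m^k(d) = pᵀ(x^k + d) + h(c(x^k) + ∇c(x^k)d) subject to x^k + d ∈ Ω and ‖d‖∞ ≤ Δ^k; with ρ^k = (φ(x^k) − φ(x^k + d^k)) / (m^k(0) − m^k(d^k)), set x^{k+1} = x^k + d^k if ρ^k ≥ ρ̲ and x^{k+1} = x^k otherwise; set Δ^{k+1} = c₂Δ^k if ρ^k < η̲, Δ^{k+1} = min{c₁Δ^k, Δ̄} if ρ^k > η̄, and Δ^{k+1} = Δ^k otherwise. If φ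 is bounded below and {x^k} is bounded, then there is a subsequence of {x^k} converging to a point x∞ ∈ Ω for which there exists λ* ∈ ∂h(c(x∞)) with −(p + ∇c(x∞)ᵀλ*) ∈ N_Ω(x∞). -/
open Matrix Filter

lemma aux_lip {mdim M : ℕ} (hvec : Fin M → (Fin mdim → ℝ)) (β : Fin M → ℝ)
    (h : (Fin mdim → ℝ) → ℝ)
    (hh : ∀ u, IsGreatest {v : ℝ | ∃ j, v = hvec j ⬝ᵥ u + β j} (h u)) :
    ∃ L : ℝ, 0 < L ∧ ∀ u v, |h u - h v| ≤ L * ‖u - v‖ := by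
  have h0 : 0 ≤ ∑ j, ∑ i, |hvec j i| :=
    Finset.sum_nonneg fun j _ => Finset.sum_nonneg fun i _ => abs_nonneg _
  refine ⟨(∑ j, ∑ i, |hvec j i|) + 1, by linarith, ?_⟩
  have key : ∀ u v, h u - h v ≤ ((∑ j, ∑ i, |hvec j i|) + 1) * ‖u - v‖ := by
    intro u v
    obtain ⟨j, hj⟩ := (hh u).1
    have h2 : hvec j ⬝ᵥ v + β j ≤ h v := (hh v).2 ⟨j, rfl⟩
    have h3 : hvec j ⬝ᵥ (u - v) ≤ (∑ i, |hvec j i|) * ‖u - v‖ := by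
      rw [dotProduct, Finset.sum_mul]
      refine Finset.sum_le_sum fun i _ => ?_
      calc hvec j i * (u - v) i ≤ |hvec j i * (u - v) i| := le_abs_self _
        _ = |hvec j i| * |(u - v) i| := abs_mul _ _
        _ ≤ _ := mul_le_mul_of_nonneg_left (norm_le_pi_norm (u - v) i) (abs_nonneg _)
    have h4 : (∑ i, |hvec j i|) ≤ ∑ j, ∑ i, |hvec j i| :=
      Finset.single_le_sum (f := fun j => ∑ i, |hvec j i|)
        (fun j _ => Finset.sum_nonneg fun i _ => abs_nonneg _) (Finset.mem_univ j)
    have h5 := mul_le_mul_of_nonneg_right h4 (norm_nonneg (u - v))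
    rw [dotProduct_sub] at h3
    have := norm_nonneg (u - v)
    linarith
  intro u v
  rw [abs_le]
  have h1 := key u v
  have h2 := key v u
  rw [norm_sub_rev] at h2
  constructor <;> linarith

lemma aux_conv {mdim M : ℕ} (hvec : Fin M → (Fin mdim → ℝ)) (β : Fin M → ℝ)
    (h : (Fin mdim → ℝ) → ℝ)
    (hh : ∀ u, IsGreatest {v : ℝ | ∃ j, v = hvec j ⬝ᵥ u + β j} (h u))
    (u w : Fin mdim → ℝ) (t : ℝ) (ht0 : 0 ≤ t) (ht1 : t ≤ 1) :
    h (u + t • w) - h u ≤ t * (h (u + w) - h u) := by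
  obtain ⟨j, hj⟩ := (hh (u + t • w)).1
  have h1 : hvec j ⬝ᵥ u + β j ≤ h u := (hh u).2 ⟨j, rfl⟩
  have h2 : hvec j ⬝ᵥ (u + w) + β j ≤ h (u + w) := (hh _).2 ⟨j, rfl⟩
  rw [hj]
  simp only [dotProduct_add, dotProduct_smul, smul_eq_mul] at *
  nlinarith

lemma aux_Fcont {n mdim : ℕ} (J : (Fin n → ℝ) → Matrix (Fin mdim) (Fin n) ℝ)
    (hJcont : Continuous J) :
    Continuous (fun y => LinearMap.toContinuousLinearMap (J y).mulVecLin) := by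
  let T : Matrix (Fin mdim) (Fin n) ℝ →ₗ[ℝ] ((Fin n → ℝ) →L[ℝ] (Fin mdim → ℝ)) :=
    (LinearMap.toContinuousLinearMap.toLinearMap).comp (Matrix.toLin').toLinearMap
  have hT : Continuous T := T.continuous_of_finiteDimensional
  exact hT.comp hJcont

lemma aux_taylor {n mdim : ℕ} (c : (Fin n → ℝ) → (Fin mdim → ℝ))
    (J : (Fin n → ℝ) → Matrix (Fin mdim) (Fin n) ℝ)
    (hc : ∀ y, HasFDerivAt c (LinearMap.toContinuousLinearMap (J y).mulVecLin) y)
    (hJcont : Continuous J) (R ε : ℝ) (hε : 0 < ε) :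
    ∃ δ : ℝ, 0 < δ ∧ ∀ x d : Fin n → ℝ, ‖x‖ ≤ R → ‖d‖ ≤ δ →
      ‖c (x + d) - (c x + (J x).mulVec d)‖ ≤ ε * ‖d‖ := by
  have huc := (isCompact_closedBall (0 : Fin n → ℝ) (R + 1)).uniformContinuousOn_of_continuous
    (aux_Fcont J hJcont).continuousOn
  rw [Metric.uniformContinuousOn_iff] at huc
  obtain ⟨δ, hδ, H⟩ := huc ε hε
  refine ⟨min (δ / 2) 1, by positivity, ?_⟩
  intro x d hx hd
  have hd1 : ‖d‖ ≤ δ / 2 := hd.trans (min_le_left _ _)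
  have hd2 : ‖d‖ ≤ 1 := hd.trans (min_le_right _ _)
  have := (convex_closedBall x ‖d‖).norm_image_sub_le_of_norm_hasFDerivWithin_le'
    (f := c) (f' := fun y => LinearMap.toContinuousLinearMap (J y).mulVecLin)
    (φ := LinearMap.toContinuousLinearMap (J x).mulVecLin) (C := ε) (x := x) (y := x + d)
    (fun y _ => (hc y).hasFDerivWithinAt)
    (by
      intro y hy
      rw [Metric.mem_closedBall] at hy
      rw [← dist_eq_norm]
      refine (H y ?_ x ?_ (by linarith)).le
      · rw [Metric.mem_closedBall]
        have := dist_triangle y x 0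
        rw [dist_zero_right x] at this
        linarith
      · rw [mem_closedBall_zero_iff]; linarith)
    (by simp) (by simp)
  have e : x + d - x = d := by abel
  rw [e] at this
  rw [← sub_sub]
  exact this

lemma aux_mult {n mdim M : ℕ} (hM : 0 < M) (p : Fin n → ℝ)
    (hvec : Fin M → (Fin mdim → ℝ)) (β : Fin M → ℝ)
    (h : (Fin mdim → ℝ) → ℝ)
    (hh : ∀ u, IsGreatest {v : ℝ | ∃ j, v = hvec j ⬝ᵥ u + β j} (h u))
    (Ω : Set (Fin n → ℝ)) (hconv : Convex ℝ Ω) (xb : Fin n → ℝ) (hxb : xb ∈ Ω)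
    (A : Matrix (Fin mdim) (Fin n) ℝ) (cb : Fin mdim → ℝ)
    (hst : ∀ y ∈ Ω, h cb ≤ p ⬝ᵥ (y - xb) + h (cb + A.mulVec (y - xb))) :
    ∃ lam : Fin M → ℝ,
        (∀ j, 0 ≤ lam j) ∧ (∑ j, lam j) = 1 ∧
        (∀ j, h cb ≠ hvec j ⬝ᵥ cb + β j → lam j = 0) ∧
        ∀ x' ∈ Ω, (-(p + Aᵀ.mulVec (∑ j, lam j • hvec j))) ⬝ᵥ (x' - xb) ≤ 0 := by
  let G : (Fin n → ℝ) → (Fin M → ℝ) := fun y j =>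
    p ⬝ᵥ (y - xb) + hvec j ⬝ᵥ (cb + A.mulVec (y - xb)) + β j - h cb
  let U : Set (Fin M → ℝ) := Set.pi Set.univ fun _ => Set.Iio 0
  have hUo : IsOpen U := isOpen_set_pi Set.finite_univ fun _ _ => isOpen_Iio
  have hUc : Convex ℝ U := convex_pi fun _ _ => convex_Iio 0
  have hTc : Convex ℝ (G '' Ω) := by
    rintro _ ⟨y, hy, rfl⟩ _ ⟨z, hz, rfl⟩ a b ha hb hab
    refine ⟨a • y + b • z, hconv hy hz ha hb hab, ?_⟩
    have e : a • y + b • z - xb = a • (y - xb) + b • (z - xb) := by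
      have : xb = (a + b) • xb := by rw [hab, one_smul]
      nth_rewrite 1 [this]
      simp only [smul_sub, add_smul]; abel
    funext j
    have hb' : b = 1 - a := by linarith
    simp only [G, e, Pi.add_apply, Pi.smul_apply, smul_eq_mul, dotProduct_add, dotProduct_smul,
      mulVec_add, mulVec_smul]
    subst hb'
    ring
  have hdis : Disjoint U (G '' Ω) := by
    rw [Set.disjoint_left]
    rintro _ hu ⟨y, hy, rfl⟩
    obtain ⟨j, hj⟩ := (hh (cb + A.mulVec (y - xb))).1
    have h1 : G y j < 0 := hu j trivial
    have h2 := hst y hy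
    simp only [G] at h1
    linarith
  obtain ⟨f, s, hfU, hfT⟩ := geometric_hahn_banach_open hUc hUo hTc hdis
  let l : Fin M → ℝ := fun j => f (Pi.single j 1)
  have hf : ∀ u, f u = ∑ j, u j * l j := by
    intro u
    have h1 : u = ∑ j, u j • (Pi.single j 1 : Fin M → ℝ) := by
      funext i
      simp [Finset.sum_apply, Pi.single_apply]
    conv_lhs => rw [h1]
    rw [map_sum]
    refine Finset.sum_congr rfl fun j _ => ?_
    rw [map_smul, smul_eq_mul]
  have hneg : ∀ t : ℝ, 0 < t → (fun _ => -t : Fin M → ℝ) ∈ U := by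
    intro t ht j _
    simpa using ht
  have hs0 : 0 ≤ s := by
    by_contra hs
    push Not at hs
    have h1 := hfU _ (hneg 1 one_pos)
    rw [hf] at h1
    simp only [← Finset.mul_sum] at h1
    set S := ∑ j, l j
    have hS : 0 < S := by linarith
    have h2 := hfU _ (hneg (-s / S) (div_pos (by linarith) hS))
    rw [hf] at h2
    simp only [← Finset.mul_sum] at h2
    change -(-s / S) * S < s at h2
    rw [neg_mul, div_mul_cancel₀ _ hS.ne'] at h2
    linarith
  have hsle : s ≤ f (G xb) := hfT _ ⟨xb, hxb, rfl⟩
  have hl : ∀ j, 0 ≤ l j := by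
    intro j
    by_contra hlj
    push Not at hlj
    have hmem : ∀ τ : ℝ, 0 ≤ τ → ((fun _ => -1 : Fin M → ℝ) + (-τ) • Pi.single j 1) ∈ U := by
      intro τ hτ i _
      have : (0:ℝ) ≤ (Pi.single j 1 : Fin M → ℝ) i := by
        by_cases hij : i = j
        · subst hij; simp
        · simp [hij]
      simp only [Set.mem_Iio, Pi.add_apply, Pi.smul_apply, smul_eq_mul]
      nlinarith
    set a := f (fun _ => -1)
    have h1 := hfU _ (hmem ((|s| + |a|) / (-l j)) (div_nonneg (by positivity) (by linarith)))
    rw [map_add, map_smul] at h1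
    change a + -((|s| + |a|) / (-l j)) * l j < s at h1
    have e : -((|s| + |a|) / (-l j)) * l j = |s| + |a| := by
      have := hlj.ne
      field_simp
    rw [e] at h1
    have := neg_abs_le a
    have := le_abs_self s
    linarith
  have hS : 0 < ∑ j, l j := by
    rcases (Finset.sum_nonneg fun j (_ : j ∈ Finset.univ) => hl j).lt_or_eq with h1 | h1
    · exact h1
    · exfalso
      have hz := (Finset.sum_eq_zero_iff_of_nonneg (fun j _ => hl j)).1 h1.symm
      have hf0 : ∀ u, f u = 0 := fun u => by
        rw [hf]
        exact Finset.sum_eq_zero fun j hj => by rw [hz j hj, mul_zero]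
      have := hfU _ (hneg 1 one_pos)
      rw [hf0] at this hsle
      linarith
  set S := ∑ j, l j with hSdef
  have hsl : ∀ j, hvec j ⬝ᵥ cb + β j ≤ h cb := fun j => (hh cb).2 ⟨j, rfl⟩
  have hGxb : ∀ j, G xb j = hvec j ⬝ᵥ cb + β j - h cb := by
    intro j; simp [G]
  have hcomp : ∀ j, (hvec j ⬝ᵥ cb + β j - h cb) * l j = 0 := by
    have h1 : 0 ≤ ∑ j, G xb j * l j := by rw [← hf]; linarith
    have h2 : ∀ j ∈ Finset.univ, G xb j * l j ≤ 0 := fun j _ =>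
      mul_nonpos_of_nonpos_of_nonneg (by rw [hGxb]; linarith [hsl j]) (hl j)
    have h3 := (Finset.sum_eq_zero_iff_of_nonpos h2).1 (le_antisymm (Finset.sum_nonpos h2) h1)
    intro j
    rw [← hGxb]
    exact h3 j (Finset.mem_univ j)
  refine ⟨fun j => l j / S, fun j => div_nonneg (hl j) hS.le, ?_, ?_, ?_⟩
  · rw [← Finset.sum_div]; exact div_self hS.ne'
  · intro j hj
    have := hcomp j
    rcases mul_eq_zero.1 this with h1 | h1
    · exact absurd (by linarith) hj
    · simp [h1]
  · intro y hy
    have h1 : 0 ≤ ∑ j, G y j * l j := by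
      rw [← hf]; exact hs0.trans (hfT _ ⟨y, hy, rfl⟩)
    have h2 : ∑ j, G y j * l j = S * (p ⬝ᵥ (y - xb)) +
        ∑ j, l j * (hvec j ⬝ᵥ A.mulVec (y - xb)) := by
      rw [hSdef, Finset.sum_mul, ← Finset.sum_add_distrib]
      refine Finset.sum_congr rfl fun j _ => ?_
      have := hcomp j
      simp only [G, dotProduct_add]
      linear_combination this
    have h3 : (p + Aᵀ.mulVec (∑ j, (l j / S) • hvec j)) ⬝ᵥ (y - xb) =
        (S * (p ⬝ᵥ (y - xb)) + ∑ j, l j * (hvec j ⬝ᵥ A.mulVec (y - xb))) / S := by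
      rw [add_dotProduct, mulVec_transpose, ← dotProduct_mulVec, sum_dotProduct, add_div,
        mul_div_cancel_left₀ _ hS.ne', Finset.sum_div]
      congr 1
      refine Finset.sum_congr rfl fun j _ => ?_
      rw [smul_dotProduct, smul_eq_mul]; ring
    rw [neg_dotProduct, h3, ← h2]
    have := div_nonneg h1 hS.le
    linarith

lemma aux_pred {n mdim M : ℕ} (p : Fin n → ℝ) (c : (Fin n → ℝ) → (Fin mdim → ℝ))
    (hcc : Continuous c)
    (J : (Fin n → ℝ) → Matrix (Fin mdim) (Fin n) ℝ) (hJcont : Continuous J)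
    (hvec : Fin M → (Fin mdim → ℝ)) (β : Fin M → ℝ)
    (h : (Fin mdim → ℝ) → ℝ)
    (hh : ∀ u, IsGreatest {v : ℝ | ∃ j, v = hvec j ⬝ᵥ u + β j} (h u))
    (hhc : Continuous h)
    (Ω : Set (Fin n → ℝ)) (hconv : Convex ℝ Ω) (Δub : ℝ) (hΔub : 0 < Δub)
    (xb y : Fin n → ℝ) (hy : y ∈ Ω)
    (hneg : p ⬝ᵥ (y - xb) + h (c xb + (J xb).mulVec (y - xb)) < h (c xb)) :
    ∃ κ : ℝ, 0 < κ ∧ ∀ᶠ x in nhds xb, x ∈ Ω → ∀ D, 0 < D → D ≤ Δub →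
      ∃ d', x + d' ∈ Ω ∧ ‖d'‖ ≤ D ∧
        κ * D ≤ h (c x) - (p ⬝ᵥ d' + h (c x + (J x).mulVec d')) := by
  let g : (Fin n → ℝ) → ℝ := fun x =>
    h (c x) - (p ⬝ᵥ (y - x) + h (c x + (J x).mulVec (y - x)))
  have hg : Continuous g := by
    have h1 : Continuous fun x : Fin n → ℝ => y - x := continuous_const.sub continuous_id
    have h2 : Continuous fun x : Fin n → ℝ => (J x).mulVec (y - x) := hJcont.matrix_mulVec h1
    have h3 : Continuous fun x : Fin n → ℝ => p ⬝ᵥ (y - x) := continuous_const.dotProduct h1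
    exact (hhc.comp hcc).sub (h3.add (hhc.comp (hcc.add h2)))
  have hg0 : 0 < g xb := by simp only [g]; linarith
  set E := max (‖y - xb‖ + 1) Δub with hE
  have hEpos : 0 < E := lt_of_lt_of_le hΔub (le_max_right _ _)
  refine ⟨g xb / 2 / E, by positivity, ?_⟩
  have e1 : ∀ᶠ x in nhds xb, g xb / 2 < g x :=
    hg.continuousAt.eventually (lt_mem_nhds (by linarith))
  have e2 : ∀ᶠ x in nhds xb, ‖y - x‖ < ‖y - xb‖ + 1 := by
    have : Continuous fun x : Fin n → ℝ => ‖y - x‖ := (continuous_const.sub continuous_id).norm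
    exact this.continuousAt.eventually (gt_mem_nhds (by linarith))
  filter_upwards [e1, e2] with x hx1 hx2 hxΩ D hD hDu
  have ht0 : 0 ≤ D / E := by positivity
  have ht1 : D / E ≤ 1 := by
    rw [div_le_one hEpos]; exact hDu.trans (le_max_right _ _)
  refine ⟨(D / E) • (y - x), hconv.add_smul_sub_mem hxΩ hy ⟨ht0, ht1⟩, ?_, ?_⟩
  · rw [norm_smul, Real.norm_of_nonneg ht0]
    have : ‖y - x‖ ≤ E := hx2.le.trans (le_max_left _ _)
    calc D / E * ‖y - x‖ ≤ D / E * E := mul_le_mul_of_nonneg_left this ht0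
      _ = D := div_mul_cancel₀ _ hEpos.ne'
  · have h1 := aux_conv hvec β h hh (c x) ((J x).mulVec (y - x)) (D / E) ht0 ht1
    rw [mulVec_smul, dotProduct_smul, smul_eq_mul]
    have h2 : D / E * (g xb / 2) ≤ D / E * g x := mul_le_mul_of_nonneg_left hx1.le ht0
    have h3 : g xb / 2 / E * D = D / E * (g xb / 2) := by ring
    rw [h3]
    refine h2.trans ?_
    simp only [g]
    linarith

/-- Global convergence of the Sℓ₁LP trust-region method: some subsequence of the iterates
converges to a first-order stationary point of `φ(x) = pᵀx + h(c(x))` over the polyhedral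
convex set `Ω`. -/
theorem slp_global_convergence
    (n mdim M K : ℕ) (hM : 0 < M)
    (p : Fin n → ℝ)
    (c : (Fin n → ℝ) → (Fin mdim → ℝ))
    (J : (Fin n → ℝ) → Matrix (Fin mdim) (Fin n) ℝ)
    (hc : ∀ y, HasFDerivAt c (LinearMap.toContinuousLinearMap (J y).mulVecLin) y)
    (hJcont : Continuous J)
    (hvec : Fin M → (Fin mdim → ℝ)) (β : Fin M → ℝ)
    (h : (Fin mdim → ℝ) → ℝ)
    (hh : ∀ u, IsGreatest {v : ℝ | ∃ j, v = hvec j ⬝ᵥ u + β j} (h u))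
    (b : Fin K → (Fin n → ℝ)) (γ : Fin K → ℝ)
    (Ω : Set (Fin n → ℝ)) (hΩ : Ω = {x | ∀ i, b i ⬝ᵥ x ≤ γ i}) (hΩne : Ω.Nonempty)
    (ρlb ηlb ηub c1 c2 Δub : ℝ)
    (hρlb : 0 < ρlb) (hρη : ρlb < ηlb) (hηlb : ηlb < 0.5)
    (hηub : 0.5 < ηub) (hηub1 : ηub < 1)
    (hc2 : 0 < c2) (hc21 : c2 < 1) (hc1 : 1 < c1) (hΔub : 0 < Δub)
    (x d : ℕ → (Fin n → ℝ)) (Δ : ℕ → ℝ)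
    (φ : (Fin n → ℝ) → ℝ) (hφ : φ = fun y => p ⬝ᵥ y + h (c y))
    (mdl : ℕ → (Fin n → ℝ) → ℝ)
    (hmdl : mdl = fun k dd => p ⬝ᵥ (x k + dd) + h (c (x k) + (J (x k)).mulVec dd))
    (ρk : ℕ → ℝ)
    (hρk : ρk = fun k => (φ (x k) - φ (x k + d k)) / (mdl k 0 - mdl k (d k)))
    (hx0 : x 0 ∈ Ω) (hΔ0 : 0 < Δ 0 ∧ Δ 0 ≤ Δub)
    -- d k is a global minimizer of the trust-region LP subproblem
    (hdk : ∀ k, (x k + d k ∈ Ω ∧ ‖d k‖ ≤ Δ k) ∧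
      ∀ d' : Fin n → ℝ, x k + d' ∈ Ω → ‖d'‖ ≤ Δ k → mdl k (d k) ≤ mdl k d')
    -- step acceptance rule
    (hxupd : ∀ k, x (k + 1) = if ρlb ≤ ρk k then x k + d k else x k)
    -- trust region update rule
    (hΔupd : ∀ k, Δ (k + 1) = if ρk k < ηlb then c2 * Δ k
      else if ηub < ρk k then min (c1 * Δ k) Δub else Δ k)
    (hbdd : ∃ B : ℝ, ∀ y, B ≤ φ y)
    (hxbdd : ∃ R : ℝ, ∀ k, ‖x k‖ ≤ R) :
    ∃ (xinf : Fin n → ℝ) (σ : ℕ → ℕ), xinf ∈ Ω ∧ StrictMono σ ∧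
      Tendsto (fun k => x (σ k)) atTop (nhds xinf) ∧
      ∃ lam : Fin M → ℝ,
        (∀ j, 0 ≤ lam j) ∧ (∑ j, lam j) = 1 ∧
        (∀ j, h (c xinf) ≠ hvec j ⬝ᵥ c xinf + β j → lam j = 0) ∧
        ∀ x' ∈ Ω, (-(p + (J xinf)ᵀ.mulVec (∑ j, lam j • hvec j))) ⬝ᵥ (x' - xinf) ≤ 0 := by
  obtain ⟨L, hL, hLip⟩ := aux_lip hvec β h hh
  have hhc : Continuous h := by
    refine (LipschitzWith.of_dist_le_mul (K := ⟨L, hL.le⟩) fun u v => ?_).continuous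
    rw [Real.dist_eq, dist_eq_norm]; exact hLip u v
  have hcc : Continuous c := continuous_iff_continuousAt.2 fun y => (hc y).continuousAt
  have hset : Ω = ⋂ i, {x | b i ⬝ᵥ x ≤ γ i} := by
    rw [hΩ]; ext; simp
  have hconv : Convex ℝ Ω := by
    rw [hset]
    refine convex_iInter fun i => ?_
    exact convex_halfSpace_le ⟨fun x y => dotProduct_add _ _ _, fun a x => dotProduct_smul _ _ _⟩ _
  have hclosed : IsClosed Ω := by
    rw [hset]
    refine isClosed_iInter fun i => ?_
    exact isClosed_le (continuous_const.dotProduct continuous_id) continuous_const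
  have hxΩ : ∀ k, x k ∈ Ω := by
    intro k
    induction k with
    | zero => exact hx0
    | succ k ih =>
      rw [hxupd]
      split_ifs
      · exact (hdk k).1.1
      · exact ih
  have hΔ : ∀ k, 0 < Δ k ∧ Δ k ≤ Δub := by
    intro k
    induction k with
    | zero => exact hΔ0
    | succ k ih =>
      rw [hΔupd]
      split_ifs
      · exact ⟨mul_pos hc2 ih.1, by nlinarith [ih.1, ih.2]⟩
      · exact ⟨lt_min (mul_pos (by linarith) ih.1) hΔub, min_le_right _ _⟩
      · exact ih
  have hm0 : ∀ k, mdl k 0 = φ (x k) := by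
    intro k; simp [hmdl, hφ]
  have hpred0 : ∀ k, 0 ≤ mdl k 0 - mdl k (d k) := by
    intro k
    have := (hdk k).2 0 (by simpa using hxΩ k) (by simpa using (hΔ k).1.le)
    linarith
  obtain ⟨R, hR⟩ := hxbdd
  obtain ⟨B, hB⟩ := hbdd
  by_cases hex : ∃ (xinf : Fin n → ℝ) (σ : ℕ → ℕ), xinf ∈ Ω ∧ StrictMono σ ∧
      Tendsto (fun k => x (σ k)) atTop (nhds xinf) ∧
      ∀ y ∈ Ω, h (c xinf) ≤ p ⬝ᵥ (y - xinf) + h (c xinf + (J xinf).mulVec (y - xinf))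
  · obtain ⟨xinf, σ, h1, h2, h3, h4⟩ := hex
    exact ⟨xinf, σ, h1, h2, h3, aux_mult hM p hvec β h hh Ω hconv xinf h1 (J xinf) (c xinf) h4⟩
  exfalso
  push Not at hex
  -- uniform predicted decrease
  have hκ : ∃ κ : ℝ, 0 < κ ∧ ∃ N, ∀ k, N ≤ k → κ * Δ k ≤ mdl k 0 - mdl k (d k) := by
    by_contra hcon
    push Not at hcon
    have hP : ∀ N : ℕ, ∃ k > N, mdl k 0 - mdl k (d k) < 1 / ((N : ℝ) + 1) * Δ k := by
      intro N
      obtain ⟨k, hk, hk2⟩ := hcon (1 / ((N : ℝ) + 1)) (by positivity) (N + 1)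
      exact ⟨k, hk, hk2⟩
    have hP2 : ∀ N : ℕ, ∃ k, ∃ _ : N < k, mdl k 0 - mdl k (d k) < 1 / ((N : ℝ) + 1) * Δ k := by
      intro N
      obtain ⟨k, hk, hk2⟩ := hP N
      exact ⟨k, hk, hk2⟩
    choose g hg1 hg2 using hP2
    obtain ⟨xb, -, τ, hτ, hlim⟩ := (isCompact_closedBall (0 : Fin n → ℝ) R).tendsto_subseq
      (x := fun N => x (g N)) (fun N => by simpa using hR (g N))
    -- extract strictly monotone subsequence of indices
    have hgt : Tendsto (fun N => g (τ N)) atTop atTop := by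
      refine tendsto_atTop_mono (fun N => ?_) tendsto_id
      exact (hτ.id_le N).trans (hg1 _).le
    obtain ⟨ψ, hψ, hψ2⟩ := strictMono_subseq_of_tendsto_atTop hgt
    have hlim2 : Tendsto (fun k => x (g (τ (ψ k)))) atTop (nhds xb) :=
      hlim.comp hψ.tendsto_atTop
    have hxbΩ : xb ∈ Ω := hclosed.mem_of_tendsto hlim2 (Eventually.of_forall fun k => hxΩ _)
    obtain ⟨y, hy, hneg⟩ := hex xb _ hxbΩ hψ2 hlim2
    obtain ⟨κ, hκ, hev⟩ := aux_pred p c hcc J hJcont hvec β h hh hhc Ω hconv Δub hΔub xb y hy hneg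
    have hev2 := hlim.eventually hev
    have hsm : Tendsto (fun N => 1 / (((τ N : ℕ) : ℝ) + 1)) atTop (nhds 0) :=
      tendsto_one_div_add_atTop_nhds_zero_nat.comp hτ.tendsto_atTop
    obtain ⟨N, hN1, hN2⟩ := (hev2.and (hsm.eventually (gt_mem_nhds hκ))).exists
    set k := g (τ N) with hk
    obtain ⟨d', hd1, hd2, hd3⟩ := hN1 (hxΩ k) (Δ k) (hΔ k).1 (hΔ k).2
    have h1 := (hdk k).2 d' hd1 hd2
    have h2 := hg2 (τ N)
    rw [← hk] at h2
    have h3 : mdl k d' = p ⬝ᵥ x k + (p ⬝ᵥ d' + h (c (x k) + (J (x k)).mulVec d')) := by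
      rw [hmdl]; simp only [dotProduct_add]; ring
    have h4 : mdl k 0 = p ⬝ᵥ x k + h (c (x k)) := by rw [hm0, hφ]
    have h5 := mul_lt_mul_of_pos_right hN2 (hΔ k).1
    simp only [Function.comp] at hd3
    rw [← hk] at hd3
    linarith
  obtain ⟨κ, hκ, N, hN⟩ := hκ
  -- ratio is good for small radius
  obtain ⟨δ, hδ, hT⟩ := aux_taylor c J hc hJcont R (κ / (2 * L)) (by positivity)
  have hgood : ∀ k, N ≤ k → Δ k ≤ δ → ηlb ≤ ρk k := by
    intro k hk hkδ
    have h1 := hT (x k) (d k) (hR k) ((hdk k).1.2.trans hkδ)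
    have h2 := hLip (c (x k + d k)) (c (x k) + (J (x k)).mulVec (d k))
    have h3 : L * ‖c (x k + d k) - (c (x k) + (J (x k)).mulVec (d k))‖ ≤ κ / 2 * Δ k := by
      calc _ ≤ L * (κ / (2 * L) * ‖d k‖) := mul_le_mul_of_nonneg_left h1 hL.le
        _ = κ / 2 * ‖d k‖ := by field_simp
        _ ≤ _ := mul_le_mul_of_nonneg_left (hdk k).1.2 (by positivity)
    have h4 := hN k hk
    have hpos : 0 < mdl k 0 - mdl k (d k) := lt_of_lt_of_le (mul_pos hκ (hΔ k).1) h4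
    have h5 : φ (x k + d k) - mdl k (d k) ≤ κ / 2 * Δ k := by
      have := (le_abs_self _).trans (h2.trans h3)
      rw [hφ, hmdl]; simp only; linarith
    have h6 : (1:ℝ)/2 ≤ ρk k := by
      rw [hρk]
      simp only
      rw [le_div_iff₀ hpos, ← hm0]
      linarith
    norm_num at hηlb
    linarith
  -- lower bound on radius
  obtain ⟨r, hr, hrk⟩ : ∃ r : ℝ, 0 < r ∧ ∀ k, N ≤ k → r ≤ Δ k := by
    refine ⟨min (Δ N) (c2 * δ), lt_min (hΔ N).1 (mul_pos hc2 hδ), ?_⟩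
    intro k hk
    induction k, hk using Nat.le_induction with
    | base => exact min_le_left _ _
    | succ k hk ih =>
      rw [hΔupd]
      split_ifs with h1 h2
      · refine (min_le_right _ _).trans (mul_le_mul_of_nonneg_left ?_ hc2.le)
        by_contra h3
        push Not at h3
        linarith [hgood k hk h3.le]
      · refine le_min (ih.trans ?_) (ih.trans (hΔ k).2)
        nlinarith [(hΔ k).1]
      · exact ih
  -- infinitely many good steps
  have hinf : ∀ K', N ≤ K' → ∃ k, K' ≤ k ∧ ηlb ≤ ρk k := by
    intro K' hK'
    by_contra hcon
    push Not at hcon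
    have hgeo : ∀ i, Δ (K' + i) = c2 ^ i * Δ K' := by
      intro i
      induction i with
      | zero => simp
      | succ i ih =>
        rw [← add_assoc, hΔupd, if_pos (hcon _ (Nat.le_add_right _ _)), ih]; ring
    have hlim : Tendsto (fun i : ℕ => c2 ^ i * Δ K') atTop (nhds 0) := by
      simpa using (tendsto_pow_atTop_nhds_zero_of_lt_one hc2.le hc21).mul_const (Δ K')
    obtain ⟨i, hi⟩ := (hlim.eventually (gt_mem_nhds hr)).exists
    have := hrk (K' + i) (hK'.trans (Nat.le_add_right _ _))
    rw [hgeo] at this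
    linarith
  have hdec : ∀ k t, 0 < t → ρlb ≤ t → t ≤ ρk k →
      φ (x (k + 1)) ≤ φ (x k) - t * (mdl k 0 - mdl k (d k)) := by
    intro k t ht ht1 ht2
    rw [hxupd, if_pos (ht1.trans ht2)]
    have hpos : 0 < mdl k 0 - mdl k (d k) := by
      rcases (hpred0 k).lt_or_eq with h1 | h1
      · exact h1
      · rw [hρk] at ht2
        simp only [← h1, div_zero] at ht2
        linarith
    rw [hρk] at ht2
    simp only at ht2
    rw [le_div_iff₀ hpos] at ht2
    linarith
  have hanti : Antitone fun k => φ (x k) := by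
    refine antitone_nat_of_succ_le fun k => ?_
    by_cases hk : ρlb ≤ ρk k
    · have := hdec k ρlb hρlb le_rfl hk
      have := mul_nonneg hρlb.le (hpred0 k)
      linarith
    · rw [hxupd, if_neg hk]
  have hηpos : 0 < ηlb := hρlb.trans hρη
  have hq : 0 < ηlb * (κ * r) := by positivity
  have hsteps : ∀ i : ℕ, ∃ k, N ≤ k ∧ φ (x k) ≤ φ (x N) - i * (ηlb * (κ * r)) := by
    intro i
    induction i with
    | zero => exact ⟨N, le_rfl, by simp⟩
    | succ i ih =>
      obtain ⟨k, hk, hki⟩ := ih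
      obtain ⟨k', hk', hg⟩ := hinf k hk
      refine ⟨k' + 1, by omega, ?_⟩
      have h1 := hdec k' ηlb hηpos hρη.le hg
      have h2 : φ (x k') ≤ φ (x k) := hanti hk'
      have h3 : κ * r ≤ mdl k' 0 - mdl k' (d k') :=
        (mul_le_mul_of_nonneg_left (hrk k' (hk.trans hk')) hκ.le).trans (hN k' (hk.trans hk'))
      have h4 := mul_le_mul_of_nonneg_left h3 hηpos.le
      push_cast
      linarith
  obtain ⟨i, hi⟩ := exists_nat_gt ((φ (x N) - B) / (ηlb * (κ * r)))
  rw [div_lt_iff₀ hq] at hi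
  obtain ⟨k, -, hk⟩ := hsteps i
  linarith [hB (x k)]
end

section
/- Let Ω ⊆ ℝⁿ be a polyhedral convex set, x∞ ∈ Ω, p ∈ ℝⁿ, let c : ℝⁿ → ℝᵐ be differentiable at x∞, and let h : ℝᵐ → ℝ be polyhedral convex, h(c) = max_{j=1,…,M}(hⱼᵀc + βⱼ). If for every s in the feasible direction cone F_Ω(x∞) one has max_{λ ∈ ∂h(c(x∞))} sᵀ(p + ∇c(x∞)ᵀλ) ≥ 0, then there exists λ* ∈ ∂h(c(x∞)) such that −(p + ∇c(x∞)ᵀλ*) ∈ N_Ω(x∞); i.e., x∞ satisfies the first-order optimality condition 0 ∈ p + ∇c(x∞)ᵀλ* + N_Ω(x∞). -/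
open Matrix

theorem farkas_aux {ι V : Type*} [Fintype ι] [DecidableEq ι] [AddCommGroup V] [Module ℝ V]
    (t : Finset ι) : ∀ (a : ι → V →ₗ[ℝ] ℝ) (f : V →ₗ[ℝ] ℝ),
      (∀ x, (∀ i ∈ t, a i x ≤ 0) → f x ≤ 0) →
      ∃ l : ι → ℝ, (∀ i, 0 ≤ l i) ∧ (∀ i, i ∉ t → l i = 0) ∧
        ∀ x, f x = ∑ i, l i * a i x := by
  induction t using Finset.induction_on with
  | empty =>
    intro a f hf
    refine ⟨fun _ => 0, by simp, by simp, fun x => ?_⟩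
    have h1 := hf x (by simp)
    have h2 := hf (-x) (by simp)
    simp only [map_neg] at h2
    simp only [zero_mul, Finset.sum_const_zero]
    linarith
  | insert k t hk ih =>
    intro a f hf
    by_cases hc : ∀ x, (∀ i ∈ t, a i x ≤ 0) → f x ≤ 0
    · obtain ⟨l, h0, h1, h2⟩ := ih a f hc
      exact ⟨l, h0, fun i hi => h1 i fun h => hi (Finset.mem_insert_of_mem h), h2⟩
    · push Not at hc
      obtain ⟨y, hy, hfy⟩ := hc
      have hky : 0 < a k y := by
        by_contra hcon
        have := hf y (by
          intro i hi
          rcases Finset.mem_insert.1 hi with rfl | hi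
          · linarith
          · exact hy i hi)
        linarith
      obtain ⟨l, h0, h1, h2⟩ := ih (fun i => a i - (a i y / a k y) • a k)
        (f - (f y / a k y) • a k) (by
          intro x hx
          have := hf (x - (a k x / a k y) • y) (by
            intro i hi
            rcases Finset.mem_insert.1 hi with rfl | hi
            · simp only [map_sub, map_smul, smul_eq_mul]
              rw [div_mul_cancel₀ _ hky.ne']
              simp
            · have := hx i hi
              simp only [map_sub, map_smul, smul_eq_mul, LinearMap.sub_apply,
                LinearMap.smul_apply] at this ⊢
              calc _ = _ := by ring
                _ ≤ 0 := this)
          simp only [map_sub, map_smul, smul_eq_mul, LinearMap.sub_apply,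
                LinearMap.smul_apply] at this ⊢
          calc _ = _ := by ring
            _ ≤ 0 := this)
      have hlk : l k = 0 := h1 k hk
      have hnn : 0 ≤ f y / a k y - ∑ i, l i * (a i y / a k y) := by
        have h3 : ∑ i, l i * (a i y / a k y) ≤ 0 := by
          apply Finset.sum_nonpos
          intro i _
          by_cases hi : i ∈ t
          · exact mul_nonpos_of_nonneg_of_nonpos (h0 i)
              (div_nonpos_of_nonpos_of_nonneg (hy i hi) hky.le)
          · simp [h1 i hi]
        have : 0 < f y / a k y := div_pos hfy hky
        linarith
      refine ⟨fun i => l i + if i = k then f y / a k y - ∑ i, l i * (a i y / a k y) else 0,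
        ?_, ?_, ?_⟩
      · intro i
        have := h0 i
        dsimp only
        split_ifs <;> linarith
      · intro i hi
        rw [Finset.mem_insert, not_or] at hi
        simp [hi.1, h1 i hi.2]
      · intro x
        have := h2 x
        simp only [LinearMap.sub_apply, LinearMap.smul_apply, smul_eq_mul, mul_sub,
          Finset.sum_sub_distrib] at this
        simp only [add_mul, Finset.sum_add_distrib, ite_mul, zero_mul, Finset.sum_ite_eq',
          Finset.mem_univ, if_true, sub_mul, Finset.sum_mul, mul_assoc]
        linarith

/-- If for every feasible direction `s` at `x∞` the maximum of `sᵀ(p + ∇c(x∞)ᵀλ)` over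
`λ ∈ ∂h(c(x∞))` is nonnegative, then some `λ* ∈ ∂h(c(x∞))` satisfies the first-order
optimality condition `0 ∈ p + ∇c(x∞)ᵀλ* + N_Ω(x∞)`. -/
theorem firstOrder_stationarity_from_feasible_directions
    (n mdim M K : ℕ) (hM : 0 < M)
    (b : Fin K → (Fin n → ℝ)) (γ : Fin K → ℝ)
    (Ω : Set (Fin n → ℝ)) (hΩ : Ω = {x | ∀ i, b i ⬝ᵥ x ≤ γ i})
    (xinf : Fin n → ℝ) (hxinf : xinf ∈ Ω)
    (p : Fin n → ℝ)
    (c : (Fin n → ℝ) → (Fin mdim → ℝ))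
    (J : Matrix (Fin mdim) (Fin n) ℝ)
    (hc : HasFDerivAt c (LinearMap.toContinuousLinearMap J.mulVecLin) xinf)
    (hvec : Fin M → (Fin mdim → ℝ)) (β : Fin M → ℝ)
    (h : (Fin mdim → ℝ) → ℝ)
    (hh : ∀ u, IsGreatest {v : ℝ | ∃ j, v = hvec j ⬝ᵥ u + β j} (h u))
    -- `S` is the subdifferential ∂h(c(x∞))
    (S : Set (Fin mdim → ℝ))
    (hS : S = {lamv | ∃ lam : Fin M → ℝ, (∀ j, 0 ≤ lam j) ∧ (∑ j, lam j) = 1 ∧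
      (∀ j, h (c xinf) ≠ hvec j ⬝ᵥ c xinf + β j → lam j = 0) ∧
      lamv = ∑ j, lam j • hvec j})
    -- for each feasible direction the max over the subdifferential is ≥ 0
    (hyp : ∀ s : Fin n → ℝ, (∀ i, b i ⬝ᵥ xinf = γ i → b i ⬝ᵥ s ≤ 0) →
      ∃ lamv ∈ S, 0 ≤ s ⬝ᵥ (p + Jᵀ.mulVec lamv)) :
    ∃ lamv ∈ S, ∃ lamb : Fin K → ℝ, (∀ i, 0 ≤ lamb i) ∧
      (∀ i, b i ⬝ᵥ xinf ≠ γ i → lamb i = 0) ∧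
      -(p + Jᵀ.mulVec lamv) = ∑ i, lamb i • b i := by
  classical
  subst hS
  let L : (Fin n → ℝ) → ℝ → ((Fin n → ℝ) × ℝ) →ₗ[ℝ] ℝ := fun w r =>
    { toFun := fun x => w ⬝ᵥ x.1 + r * x.2
      map_add' := by intro x y; simp [dotProduct_add]; ring
      map_smul' := by intro k x; simp [dotProduct_smul]; ring }
  have hL : ∀ w r x, L w r x = w ⬝ᵥ x.1 + r * x.2 := fun _ _ _ => rfl
  let g : Fin M → Fin n → ℝ := fun j => p + Jᵀ.mulVec (hvec j)
  have key : ∀ lam : Fin M → ℝ, ∑ j, lam j = 1 →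
      p + Jᵀ.mulVec (∑ j, lam j • hvec j) = ∑ j, lam j • g j := by
    intro lam h1
    simp only [g, smul_add, Finset.sum_add_distrib, ← Finset.sum_smul, h1, one_smul]
    congr 1
    rw [← Matrix.mulVecLin_apply, map_sum]
    simp only [map_smul, Matrix.mulVecLin_apply]
  let a : Fin K ⊕ Fin M → ((Fin n → ℝ) × ℝ) →ₗ[ℝ] ℝ :=
    Sum.elim (fun i => L (b i) 0) (fun j => L (g j) 1)
  let T : Finset (Fin K ⊕ Fin M) := Finset.univ.filter fun q =>
    Sum.elim (fun i => b i ⬝ᵥ xinf = γ i) (fun j => h (c xinf) = hvec j ⬝ᵥ c xinf + β j) q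
  obtain ⟨l, h0, h1, h2⟩ := farkas_aux T a (L 0 1) (by
    rintro ⟨s, t⟩ hx
    obtain ⟨lamv, ⟨lam, hl0, hl1, hl2, rfl⟩, hle⟩ := hyp s (by
      intro i hi
      have := hx (Sum.inl i) (by simp [T, hi])
      simpa [a, hL] using this)
    rw [key lam hl1, dotProduct_sum] at hle
    have : ∑ j, s ⬝ᵥ (lam j • g j) ≤ ∑ j, lam j * (-t) := by
      apply Finset.sum_le_sum
      intro j _
      by_cases hj : h (c xinf) = hvec j ⬝ᵥ c xinf + β j
      · have h3 := hx (Sum.inr j) (by simpa [T] using hj)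
        simp only [a, hL, Sum.elim_inr, one_mul] at h3
        rw [dotProduct_smul, smul_eq_mul, dotProduct_comm]
        exact mul_le_mul_of_nonneg_left (by linarith) (hl0 j)
      · simp [hl2 j hj]
    rw [← Finset.sum_mul, hl1] at this
    simp only [hL, zero_dotProduct]
    linarith)
  have hsum : ∑ j, l (Sum.inr j) = 1 := by
    have := h2 (0, 1)
    simp [a, hL] at this
    exact this.symm
  refine ⟨∑ j, l (Sum.inr j) • hvec j, ⟨fun j => l (Sum.inr j), fun j => h0 _, hsum,
    fun j hj => h1 _ (by simpa [T] using hj), rfl⟩, fun i => l (Sum.inl i), fun i => h0 _,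
    fun i hi => h1 _ (by simpa [T] using hi), ?_⟩
  rw [key _ hsum]
  ext k
  have := h2 (Pi.single k 1, 0)
  simp [a, hL] at this
  simp only [Pi.neg_apply, Finset.sum_apply, Pi.smul_apply, smul_eq_mul]
  linarith
end

section
/- Suppose (x*, λ*, μ*, ν*) satisfies the KKT conditions of the penalized problem (CNSO), the solution x* is fully determined by the constraints, and strict complementarity holds, with constant γ > 0 such that |λⱼ*| ≤ 1 − γ for all j, μᵢ* ≥ γ for i ∈ A_lb(x*), and νᵢ* ≤ −γ for i ∈ A_ub(x*). Let ζ > 0 be the smallest singular value of the nonsingular square matrix formed by stacking ω∇c(x*) on top of the rows of the identity indexed by A(x*). Then there exist ε > 0 and M > 0 such that for every x^k with x̲ ≤ x^k ≤ x̄ and ‖x^k − x*‖ ≤ ε, the step d^k characterized by c(x^k) + ∇c(x^k)d^k = 0, (x^k + d^k)ᵢ = x̲ᵢ for i ∈ A_lb(x*), and (x^k + d^k)ᵢ = x̄ᵢ for i ∈ A_ub(x*) satisfies −pᵀd^k + ω‖∇c(x^k)d^k‖₁ ≥ γζ‖d^k‖ − M‖d^k‖². -/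
open Matrix

attribute [local instance] Classical.propDecidable

set_option maxHeartbeats 2000000 in
/-- Lower bound on the model decrease denominator: for the step `d^k` matching the optimal
active set and zeroing the linearized constraints, `−pᵀd^k + ω‖∇c(x^k)d^k‖₁` is bounded
below by `γζ‖d^k‖ − M‖d^k‖²`. -/
theorem slp_model_decrease_lower_bound
    (n m : ℕ) (hnm : m ≤ n)
    (p xlb xub : Fin n → ℝ)
    (c : (Fin n → ℝ) → (Fin m → ℝ)) (hc : ContDiff ℝ 2 c)
    (J : (Fin n → ℝ) → Matrix (Fin m) (Fin n) ℝ)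
    (hJ : ∀ y, HasFDerivAt c (LinearMap.toContinuousLinearMap (J y).mulVecLin) y)
    (ω : ℝ) (hω : 0 < ω)
    (xstar : Fin n → ℝ) (lamstar : Fin m → ℝ) (mustar nustar : Fin n → ℝ)
    -- KKT conditions of the penalized problem (CNSO)
    (hkkt_stat : p + ω • ((J xstar)ᵀ.mulVec lamstar) - mustar - nustar = 0)
    (hkkt_sub : ∀ j, (0 < c xstar j → lamstar j = 1) ∧ (c xstar j < 0 → lamstar j = -1) ∧
      (c xstar j = 0 → |lamstar j| ≤ 1))
    (hkkt_lb : ∀ i, xlb i ≤ xstar i ∧ 0 ≤ mustar i ∧ (xstar i - xlb i) * mustar i = 0)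
    (hkkt_ub : ∀ i, xstar i ≤ xub i ∧ nustar i ≤ 0 ∧ (xstar i - xub i) * nustar i = 0)
    -- x* is fully determined by the constraints
    (hfull : m + Set.ncard {i | xstar i = xlb i ∨ xstar i = xub i} = n)
    (hLICQ : LinearIndependent ℝ
      (Sum.elim (fun j : Fin m => (J xstar) j)
        (fun a : {i : Fin n // xstar i = xlb i ∨ xstar i = xub i} => Pi.single a.1 (1:ℝ))))
    -- strict complementarity with margin γ
    (γ : ℝ) (hγ : 0 < γ)
    (hsc1 : ∀ j, |lamstar j| ≤ 1 - γ)
    (hsc2 : ∀ i, xstar i = xlb i → γ ≤ mustar i)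
    (hsc3 : ∀ i, xstar i = xub i → nustar i ≤ -γ)
    -- the stacked matrix [ω∇c(x*); I_{A*}] and its smallest singular value ζ
    (B : Matrix (Fin m ⊕ {i : Fin n // xstar i = xlb i ∨ xstar i = xub i}) (Fin n) ℝ)
    (hB : B = Matrix.of (Sum.elim (fun j : Fin m => ω • (J xstar) j)
      (fun a : {i : Fin n // xstar i = xlb i ∨ xstar i = xub i} => Pi.single a.1 (1:ℝ))))
    (ζ : ℝ) (hζ : 0 < ζ)
    (hζsv : ∀ v : Fin n → ℝ, ζ * ‖v‖ ≤ ‖B.mulVec v‖) :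
    ∃ ε > (0:ℝ), ∃ Mc > (0:ℝ), ∀ xk : Fin n → ℝ,
      (∀ i, xlb i ≤ xk i ∧ xk i ≤ xub i) → ‖xk - xstar‖ ≤ ε →
      ∀ dk : Fin n → ℝ,
        (∀ j, c xk j + (J xk).mulVec dk j = 0) →
        (∀ i, xstar i = xlb i → xk i + dk i = xlb i) →
        (∀ i, xstar i = xub i → xk i + dk i = xub i) →
        γ * ζ * ‖dk‖ - Mc * ‖dk‖ ^ 2 ≤
          -(p ⬝ᵥ dk) + ω * ∑ j, |(J xk).mulVec dk j| := by
  have hc0 : c xstar = 0 := by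
    funext j
    obtain ⟨h1, h2, _⟩ := hkkt_sub j
    have h3 := hsc1 j
    rcases lt_trichotomy (c xstar j) 0 with h | h | h
    · rw [h2 h] at h3; norm_num at h3; linarith
    · simpa using h
    · rw [h1 h] at h3; norm_num at h3; linarith
  obtain ⟨L, hLdef⟩ : ∃ L : (Fin n → ℝ) → ((Fin n → ℝ) →L[ℝ] (Fin m → ℝ)), L = fderiv ℝ c :=
    ⟨_, rfl⟩
  have hL : ∀ y v, L y v = (J y).mulVec v := by
    intro y v
    rw [hLdef, (hJ y).fderiv]; simp
  have hLd : ContDiff ℝ 1 L := by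
    rw [hLdef]; exact hc.fderiv_right (by norm_num)
  obtain ⟨K, t, ht, hK⟩ := (hLd.contDiffAt (x := xstar)).exists_lipschitzOnWith
  have hδ : 0 < ζ / (2 * ω) := by positivity
  have hder : HasFDerivAt c (L xstar) xstar := by
    rw [hLdef, (hJ xstar).fderiv]; exact hJ xstar
  have hlo := hder.isLittleO.def hδ
  obtain ⟨ε0, hε0, hball⟩ := Metric.eventually_nhds_iff.1 (hlo.and ht)
  obtain ⟨A, hA⟩ : ∃ A : ℝ, A = 1 + ω * (‖L xstar‖ + K) := ⟨_, rfl⟩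
  have hApos : 0 < A := by rw [hA]; positivity
  have hBl : ∀ v j, B.mulVec v (Sum.inl j) = ω * (L xstar v) j := by
    intro v j
    rw [hL, hB]
    simp [Matrix.mulVec, dotProduct, Finset.mul_sum, mul_assoc]
  have hBr : ∀ v a, B.mulVec v (Sum.inr a) = v a.1 := by
    intro v a
    rw [hB]
    simp [Matrix.mulVec]
  refine ⟨min (ε0 / 2) 1, by positivity, ω * (m * (K * (2 * A / ζ))) + 1, by positivity, ?_⟩
  intro xk hbox hxk dk hlin hdl hdu
  have hx1 : ‖xk - xstar‖ ≤ 1 := hxk.trans (min_le_right _ _)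
  have hx2 : dist xk xstar < ε0 := by
    rw [dist_eq_norm]; linarith [hxk.trans (min_le_left _ _)]
  obtain ⟨hlo1, hxt⟩ := hball hx2
  have hxst : xstar ∈ t := mem_of_mem_nhds ht
  have hLip : ‖L xk - L xstar‖ ≤ K * ‖xk - xstar‖ := hK.norm_sub_le hxt hxst
  have hdiff : ‖L xk dk - L xstar dk‖ ≤ K * ‖xk - xstar‖ * ‖dk‖ := by
    have := (L xk - L xstar).le_opNorm dk
    rw [ContinuousLinearMap.sub_apply] at this
    exact this.trans (by gcongr)
  have hck : c xk = -(L xk dk) := by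
    funext j
    have := hlin j
    rw [hL]; simp only [Pi.neg_apply]; linarith
  have hLk : ‖L xk dk‖ ≤ (‖L xstar‖ + K) * ‖dk‖ := by
    have h1 := (L xstar).le_opNorm dk
    have h2 : ‖L xk dk‖ ≤ ‖L xk dk - L xstar dk‖ + ‖L xstar dk‖ := by
      simpa using norm_add_le (L xk dk - L xstar dk) (L xstar dk)
    have h3 : K * ‖xk - xstar‖ * ‖dk‖ ≤ K * 1 * ‖dk‖ := by gcongr
    linarith
  have hLe : ‖L xstar (xk - xstar)‖ ≤
      (‖L xstar‖ + K) * ‖dk‖ + ζ / (2 * ω) * ‖xk - xstar‖ := by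
    have h1 : L xstar (xk - xstar) = c xk - (c xk - c xstar - L xstar (xk - xstar)) := by
      rw [hc0]; abel
    have h2 := norm_sub_le (c xk) (c xk - c xstar - L xstar (xk - xstar))
    rw [← h1] at h2
    have h3 : ‖c xk‖ = ‖L xk dk‖ := by rw [hck, norm_neg]
    linarith
  have hBe : ‖B.mulVec (xk - xstar)‖ ≤ ‖dk‖ + ω * ‖L xstar (xk - xstar)‖ := by
    rw [pi_norm_le_iff_of_nonneg (by positivity)]
    rintro (j | a)
    · rw [hBl, norm_mul, Real.norm_of_nonneg hω.le]
      have := norm_le_pi_norm (L xstar (xk - xstar)) j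
      have := mul_le_mul_of_nonneg_left this hω.le
      linarith [norm_nonneg dk]
    · rw [hBr]
      have h1 : (xk - xstar) a.1 = -(dk a.1) := by
        simp only [Pi.sub_apply]
        rcases a.2 with h | h
        · linarith [hdl _ h]
        · linarith [hdu _ h]
      rw [h1, norm_neg]
      have := norm_le_pi_norm dk a.1
      have : 0 ≤ ω * ‖L xstar (xk - xstar)‖ := by positivity
      linarith
  have he : ‖xk - xstar‖ ≤ 2 * A / ζ * ‖dk‖ := by
    have h1 := hζsv (xk - xstar)
    have h2 := mul_le_mul_of_nonneg_left hLe hω.le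
    have h3 : ω * ((‖L xstar‖ + K) * ‖dk‖ + ζ / (2 * ω) * ‖xk - xstar‖) =
      ω * (‖L xstar‖ + K) * ‖dk‖ + ζ / 2 * ‖xk - xstar‖ := by field_simp
    have h4 : A * ‖dk‖ = ‖dk‖ + ω * (‖L xstar‖ + K) * ‖dk‖ := by rw [hA]; ring
    have h5 : ζ * ‖xk - xstar‖ ≤ 2 * A * ‖dk‖ := by linarith
    rw [div_mul_eq_mul_div, le_div_iff₀ hζ]; linarith
  have ht1 : ∀ i, (xstar i = xlb i ∨ xstar i = xub i) →
      γ * |dk i| ≤ -((mustar i + nustar i) * dk i) := by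
    intro i hi
    have hb := hbox i
    have hl := hkkt_lb i
    have hu := hkkt_ub i
    by_cases h1 : xstar i = xlb i
    · by_cases h2 : xstar i = xub i
      · have : dk i = 0 := by linarith [hdl i h1]
        simp [this]
      · have hn : nustar i = 0 := by
          rcases mul_eq_zero.1 hu.2.2 with h | h
          · exact absurd (sub_eq_zero.1 h) h2
          · exact h
        have hd : dk i ≤ 0 := by linarith [hdl i h1]
        rw [abs_of_nonpos hd, hn]
        nlinarith [hsc2 i h1]
    · have h2 := hi.resolve_left h1
      have hn : mustar i = 0 := by
        rcases mul_eq_zero.1 hl.2.2 with h | h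
        · exact absurd (sub_eq_zero.1 h) h1
        · exact h
      have hd : 0 ≤ dk i := by linarith [hdu i h2]
      rw [abs_of_nonneg hd, hn]
      nlinarith [hsc3 i h2]
  have ht0 : ∀ i, 0 ≤ -((mustar i + nustar i) * dk i) := by
    intro i
    by_cases hi : xstar i = xlb i ∨ xstar i = xub i
    · exact le_trans (by positivity) (ht1 i hi)
    · push Not at hi
      have hm : mustar i = 0 := by
        rcases mul_eq_zero.1 (hkkt_lb i).2.2 with h | h
        · exact absurd (sub_eq_zero.1 h) hi.1
        · exact h
      have hn : nustar i = 0 := by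
        rcases mul_eq_zero.1 (hkkt_ub i).2.2 with h | h
        · exact absurd (sub_eq_zero.1 h) hi.2
        · exact h
      simp [hm, hn]
  have hs1 : ∀ j, γ * |(L xstar dk) j| ≤ |(L xstar dk) j| + lamstar j * (L xstar dk) j := by
    intro j
    have h1 := neg_abs_le (lamstar j * (L xstar dk) j)
    rw [abs_mul] at h1
    nlinarith [hsc1 j, abs_nonneg ((L xstar dk) j)]
  have hs0 : ∀ j, 0 ≤ |(L xstar dk) j| + lamstar j * (L xstar dk) j :=
    fun j => le_trans (by positivity) (hs1 j)
  have hS0 : 0 ≤ ∑ i, -((mustar i + nustar i) * dk i) := Finset.sum_nonneg fun i _ => ht0 i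
  have hS1 : 0 ≤ ∑ j, (|(L xstar dk) j| + lamstar j * (L xstar dk) j) :=
    Finset.sum_nonneg fun i _ => hs0 i
  have hBd : γ * ‖B.mulVec dk‖ ≤ ∑ i, -((mustar i + nustar i) * dk i) +
      ω * ∑ j, (|(L xstar dk) j| + lamstar j * (L xstar dk) j) := by
    have hω1 := mul_nonneg hω.le hS1
    rw [mul_comm, ← le_div_iff₀ hγ, pi_norm_le_iff_of_nonneg (by positivity)]
    rintro (j | a)
    · rw [hBl, norm_mul, Real.norm_of_nonneg hω.le, le_div_iff₀ hγ, Real.norm_eq_abs]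
      have h1 := Finset.single_le_sum (fun j _ => hs0 j) (Finset.mem_univ j)
      have h2 := mul_le_mul_of_nonneg_left ((hs1 j).trans h1) hω.le
      linarith
    · rw [hBr, le_div_iff₀ hγ, Real.norm_eq_abs]
      have h1 := Finset.single_le_sum (fun i _ => ht0 i) (Finset.mem_univ a.1)
      have h2 := (ht1 _ a.2).trans h1
      linarith
  have hp : -(p ⬝ᵥ dk) = ∑ i, -((mustar i + nustar i) * dk i) +
      ω * ∑ j, lamstar j * (L xstar dk) j := by
    have h1 : p = mustar + nustar - ω • ((J xstar)ᵀ.mulVec lamstar) := by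
      rw [← sub_eq_zero, ← hkkt_stat]; abel
    have h2 : ((J xstar)ᵀ.mulVec lamstar) ⬝ᵥ dk = ∑ j, lamstar j * (L xstar dk) j := by
      rw [Matrix.mulVec_transpose, ← Matrix.dotProduct_mulVec, hL]; rfl
    rw [h1, sub_dotProduct, smul_dotProduct, h2, Finset.sum_neg_distrib, smul_eq_mul]
    have h3 : (mustar + nustar) ⬝ᵥ dk = ∑ i, (mustar i + nustar i) * dk i := rfl
    rw [h3]; ring
  have hJd : ∑ j, |(L xstar dk) j| ≤ ∑ j, |(J xk).mulVec dk j| +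
      m * (K * ‖xk - xstar‖ * ‖dk‖) := by
    have h1 : ∀ j ∈ Finset.univ, |(L xstar dk) j| ≤
        |(J xk).mulVec dk j| + K * ‖xk - xstar‖ * ‖dk‖ := by
      intro j _
      have h2 := (norm_le_pi_norm (L xk dk - L xstar dk) j).trans hdiff
      rw [Real.norm_eq_abs, Pi.sub_apply] at h2
      have h3 := abs_sub_abs_le_abs_sub ((L xstar dk) j) ((L xk dk) j)
      rw [abs_sub_comm] at h3
      rw [← hL]; linarith
    have := Finset.sum_le_sum h1
    rw [Finset.sum_add_distrib] at this
    simpa using this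
  have hfin : (m : ℝ) * (K * ‖xk - xstar‖ * ‖dk‖) ≤ m * (K * (2 * A / ζ)) * ‖dk‖ ^ 2 := by
    have : (m : ℝ) * (K * ‖xk - xstar‖ * ‖dk‖) ≤ m * (K * (2 * A / ζ * ‖dk‖) * ‖dk‖) := by
      gcongr
    linarith
  have h1 := mul_le_mul_of_nonneg_left (hJd.trans (add_le_add_right hfin _)) hω.le
  have h2 := mul_le_mul_of_nonneg_left (hζsv dk) hγ.le
  rw [Finset.sum_add_distrib] at hBd
  rw [hp]
  nlinarith [sq_nonneg ‖dk‖]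
end

section
/- Suppose (x*, λ*, μ*, ν*) satisfies the KKT conditions of the penalized problem (CNSO), LICQ holds at x*, and the following regularity assumption holds: for every n×(n − m − |A(x*)|) matrix E whose columns are drawn from {eᵢ : i ∉ A(x*)}, the square matrix obtained by stacking ∇c(x*), the rows of the identity indexed by A(x*), and Eᵀ is nonsingular, with inverse norm bounded by a common constant ξ. Suppose further that the LP subproblem at x^k has a nondegenerate solution (d, α) = (d^k, 0) (so c(x^k) + ∇c(x^k)d^k = 0) and that x^k + d^k identifies the optimal active set exactly: (x^k + d^k)ᵢ = x̲ᵢ if and only if i ∈ A_lb(x*), and (x^k + d^k)ᵢ = x̄ᵢ if and only if i ∈ A_ub(x*). Then there exist ε > 0 and M > 0 such that whenever ‖x^k − x*‖ ≤ ε, the dual linear program of the subproblem has a solution (λ^k, μ^k, ν^k) with ‖(λ^k, μ^k, ν^k) − (λ*, μ*, ν*)‖ ≤ M‖x^k − x*‖. -/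
open Matrix

attribute [local instance] Classical.propDecidable

lemma aux_lin {n m : ℕ} (J : Matrix (Fin m) (Fin n) ℝ) (P : Fin n → Prop)
    (hcard : m + Set.ncard {i | P i} = n)
    (hLI : LinearIndependent ℝ (Sum.elim (fun j : Fin m => J j)
        (fun a : {i : Fin n // P i} => Pi.single a.1 (1:ℝ)))) :
    (∀ p : Fin n → ℝ, ∃ l : Fin m → ℝ, ∀ i, ¬ P i → p i + (Jᵀ.mulVec l) i = 0) ∧
    (∀ (u : Fin m → ℝ) (z : Fin n → ℝ), ∃ v : Fin n → ℝ, J.mulVec v = u ∧ ∀ i, P i → v i = z i) := by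
  set R : Matrix (Fin m ⊕ {i : Fin n // P i}) (Fin n) ℝ := Matrix.of (Sum.elim (fun j : Fin m => J j)
        (fun a : {i : Fin n // P i} => Pi.single a.1 (1:ℝ))) with hR
  have hc : Fintype.card (Fin m ⊕ {i : Fin n // P i}) = n := by
    rw [Fintype.card_sum, Fintype.card_fin, ← Nat.card_eq_fintype_card]
    exact hcard
  have hinj : Function.Injective R.vecMulLinear := by
    have := Matrix.vecMul_injective_iff.2 (show LinearIndependent ℝ R.row from hLI)
    exact this
  have hsurj : Function.Surjective R.vecMulLinear :=
    (LinearMap.injective_iff_surjective_of_finrank_eq_finrank (by simp only [Module.finrank_pi, hc, Fintype.card_fin])).1 hinj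
  have hinj2 : Function.Injective R.mulVecLin := by
    rw [← LinearMap.ker_eq_bot, LinearMap.ker_eq_bot']
    intro v hv
    obtain ⟨w, hw⟩ := hsurj v
    have h1 : w ⬝ᵥ R.mulVec v = 0 := by
      have : R.mulVec v = 0 := hv
      rw [this, dotProduct_zero]
    rw [Matrix.dotProduct_mulVec] at h1
    have hw' : w ᵥ* R = v := hw
    rw [hw'] at h1
    exact dotProduct_self_eq_zero.1 h1
  have hsurj2 : Function.Surjective R.mulVecLin :=
    (LinearMap.injective_iff_surjective_of_finrank_eq_finrank (by simp only [Module.finrank_pi, hc, Fintype.card_fin])).1 hinj2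
  constructor
  · intro p
    obtain ⟨w, hw⟩ := hsurj (-p)
    refine ⟨fun j => w (Sum.inl j), fun i hi => ?_⟩
    have h := congrFun (show w ᵥ* R = -p from hw) i
    simp only [Matrix.vecMul, dotProduct, Fintype.sum_sum_type, hR, Matrix.of_apply, Sum.elim_inl,
      Sum.elim_inr, Pi.neg_apply] at h
    have h0 : ∑ a : {i : Fin n // P i}, w (Sum.inr a) * (Pi.single a.1 (1:ℝ) : Fin n → ℝ) i = 0 := by
      apply Finset.sum_eq_zero
      intro a _
      have : i ≠ a.1 := fun h => hi (h ▸ a.2)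
      simp [Pi.single_apply, this]
    rw [h0] at h
    have h2 : (Jᵀ.mulVec fun j => w (Sum.inl j)) i = ∑ j, w (Sum.inl j) * J j i := by
      simp only [Matrix.mulVec, dotProduct, Matrix.transpose_apply]
      exact Finset.sum_congr rfl fun _ _ => mul_comm _ _
    rw [h2]; linarith
  · intro u z
    obtain ⟨v, hv⟩ := hsurj2 (Sum.elim u (fun a => z a.1))
    have hv' : R.mulVec v = _ := hv
    refine ⟨v, ?_, ?_⟩
    · ext j
      have := congrFun hv' (Sum.inl j)
      simpa [hR, Matrix.mulVec] using this
    · intro i hi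
      have := congrFun hv' (Sum.inr ⟨i, hi⟩)
      simpa [hR, Matrix.mulVec] using this

lemma aux_step {n : ℕ} (l u d v : Fin n → ℝ) (hd : ∀ i, l i ≤ d i ∧ d i ≤ u i)
    (h1 : ∀ i, d i = l i → 0 ≤ v i) (h2 : ∀ i, d i = u i → v i ≤ 0) :
    ∃ τ > (0:ℝ), ∀ i, l i ≤ d i + τ * v i ∧ d i + τ * v i ≤ u i := by
  have key : ∀ᶠ τ in nhdsWithin (0:ℝ) (Set.Ioi 0), ∀ i, l i ≤ d i + τ * v i ∧ d i + τ * v i ≤ u i := by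
    rw [Filter.eventually_all]
    intro i
    have ht : Filter.Tendsto (fun τ : ℝ => d i + τ * v i) (nhdsWithin (0:ℝ) (Set.Ioi 0)) (nhds (d i)) := by
      have : Continuous (fun τ : ℝ => d i + τ * v i) := by fun_prop
      have := this.tendsto 0
      simp only [zero_mul, add_zero] at this
      exact this.mono_left nhdsWithin_le_nhds
    apply Filter.Eventually.and
    · rcases (hd i).1.eq_or_lt with h | h
      · filter_upwards [self_mem_nhdsWithin] with τ hτ
        have := mul_nonneg (le_of_lt hτ) (h1 i h.symm)
        linarith
      · filter_upwards [ht.eventually (lt_mem_nhds h)] with τ hτ using hτ.le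
    · rcases (hd i).2.eq_or_lt with h | h
      · filter_upwards [self_mem_nhdsWithin] with τ hτ
        have := mul_nonneg (le_of_lt hτ) (neg_nonneg.2 (h2 i h))
        linarith
      · filter_upwards [ht.eventually (gt_mem_nhds h)] with τ hτ using hτ.le
  obtain ⟨τ, hτ, hτ0⟩ := (key.and self_mem_nhdsWithin).exists
  exact ⟨τ, hτ0, hτ⟩

lemma aux_dual {n m : ℕ} (J : Matrix (Fin m) (Fin n) ℝ) (c : Fin m → ℝ) (p l u d : Fin n → ℝ)
    (ω : ℝ) (hω : 0 < ω)
    (hd : ∀ i, l i ≤ d i ∧ d i ≤ u i)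
    (hfeas : ∀ j, c j + J.mulVec d j = 0)
    (hopt : ∀ (d' : Fin n → ℝ) (α' : Fin m → ℝ),
          (∀ j, -α' j ≤ c j + J.mulVec d' j ∧ c j + J.mulVec d' j ≤ α' j) →
          (∀ i, l i ≤ d' i ∧ d' i ≤ u i) →
          p ⬝ᵥ d ≤ p ⬝ᵥ d' + ω * ∑ j, α' j)
    (hcard : m + Set.ncard {i | d i = l i ∨ d i = u i} = n)
    (hnd : ∀ i, ¬(d i = l i ∧ d i = u i))
    (hLI : LinearIndependent ℝ
          (Sum.elim (fun j : Fin m => J j)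
            (fun a : {i : Fin n // d i = l i ∨ d i = u i} => Pi.single a.1 (1:ℝ)))) :
    ∃ (lam : Fin m → ℝ) (y : Fin n → ℝ), y = p + ω • (Jᵀ.mulVec lam) ∧ (∀ j, |lam j| ≤ 1) ∧
      (∀ i, d i = l i → 0 ≤ y i) ∧ (∀ i, d i = u i → y i ≤ 0) ∧
      (∀ i, ¬ (d i = l i ∨ d i = u i) → y i = 0) := by
  obtain ⟨hA, hB⟩ := aux_lin J (fun i => d i = l i ∨ d i = u i) hcard hLI
  obtain ⟨r, hr⟩ := hA p
  set lam : Fin m → ℝ := ω⁻¹ • r with hlam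
  set y : Fin n → ℝ := p + ω • (Jᵀ.mulVec lam) with hy
  have hωne := hω.ne'
  have hy0 : ∀ i, ¬ (d i = l i ∨ d i = u i) → y i = 0 := by
    intro i hi
    have : y i = p i + (Jᵀ.mulVec r) i := by
      simp [hy, hlam, Matrix.mulVec_smul, hωne]
    rw [this]; exact hr i hi
  -- directional optimality
  have hdir : ∀ v : Fin n → ℝ, (∀ i, d i = l i → 0 ≤ v i) → (∀ i, d i = u i → v i ≤ 0) →
      0 ≤ y ⬝ᵥ v - ω * (lam ⬝ᵥ J.mulVec v) + ω * ∑ j, |J.mulVec v j| := by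
    intro v h1 h2
    obtain ⟨τ, hτ, hτ'⟩ := aux_step l u d v hd h1 h2
    have h := hopt (d + τ • v) (fun j => τ * |J.mulVec v j|) (by
      intro j
      have e : c j + J.mulVec (d + τ • v) j = τ * J.mulVec v j := by
        rw [Matrix.mulVec_add, Matrix.mulVec_smul, Pi.add_apply, Pi.smul_apply, smul_eq_mul]
        linarith [hfeas j]
      rw [e]
      constructor
      · have := mul_le_mul_of_nonneg_left (neg_abs_le (J.mulVec v j)) hτ.le
        linarith
      · exact mul_le_mul_of_nonneg_left (le_abs_self _) hτ.le) hτ'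
    rw [dotProduct_add, dotProduct_smul, smul_eq_mul, ← Finset.mul_sum] at h
    have hp : y ⬝ᵥ v = p ⬝ᵥ v + ω * (lam ⬝ᵥ J.mulVec v) := by
      rw [hy, add_dotProduct, smul_dotProduct, smul_eq_mul, Matrix.mulVec_transpose,
        Matrix.dotProduct_mulVec]
    have h3 : 0 ≤ τ * (p ⬝ᵥ v + ω * ∑ j, |J.mulVec v j|) := by linarith
    have h4 := nonneg_of_mul_nonneg_right h3 hτ
    linarith
  have hlj : ∀ (j : Fin m) (s : ℝ), |s| = 1 → s * lam j ≤ 1 := by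
    intro j s hs
    obtain ⟨v, hv, hv0⟩ := hB (Pi.single j s) 0
    have h := hdir v (fun i hi => by rw [hv0 i (Or.inl hi)]; simp)
      (fun i hi => by rw [hv0 i (Or.inr hi)]; simp)
    have hyv : y ⬝ᵥ v = 0 := by
      apply Finset.sum_eq_zero
      intro i _
      by_cases hi : d i = l i ∨ d i = u i
      · rw [hv0 i hi]; simp
      · rw [hy0 i hi]; simp
    have hsum : ∑ j', |(Pi.single j s : Fin m → ℝ) j'| = 1 := by
      rw [Finset.sum_eq_single j]
      · simp [hs]
      · intro b _ hb; simp [Pi.single_apply, hb]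
      · simp
    rw [hv, hyv, hsum, dotProduct_single] at h
    have : 0 ≤ ω * (1 - s * lam j) := by linarith
    have := nonneg_of_mul_nonneg_right this hω
    linarith
  have hsgn : ∀ (i : Fin n) (s : ℝ), (d i = l i ∨ d i = u i) → (d i = l i → 0 ≤ s) →
      (d i = u i → s ≤ 0) → 0 ≤ s * y i := by
    intro i s hi hs1 hs2
    obtain ⟨v, hv, hv0⟩ := hB 0 (Pi.single i s)
    have h := hdir v (fun k hk => by
        rw [hv0 k (Or.inl hk)]
        by_cases hki : k = i
        · subst hki; simpa using hs1 hk
        · simp [Pi.single_apply, hki])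
      (fun k hk => by
        rw [hv0 k (Or.inr hk)]
        by_cases hki : k = i
        · subst hki; simpa using hs2 hk
        · simp [Pi.single_apply, hki])
    have hyv : y ⬝ᵥ v = y i * s := by
      unfold dotProduct
      rw [Finset.sum_eq_single i]
      · rw [hv0 i hi]; simp
      · intro k _ hki
        by_cases hk : d k = l k ∨ d k = u k
        · rw [hv0 k hk]; simp [Pi.single_apply, hki]
        · rw [hy0 k hk]; simp
      · simp
    rw [hv, hyv] at h
    simp at h
    linarith
  refine ⟨lam, y, hy, ?_, ?_, ?_, hy0⟩
  · intro j
    rw [abs_le]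
    have h1 := hlj j 1 (by simp)
    have h2 := hlj j (-1) (by simp)
    constructor <;> linarith
  · intro i hi
    have := hsgn i 1 (Or.inl hi) (fun _ => by norm_num) (fun h => absurd ⟨hi, h⟩ (hnd i))
    linarith
  · intro i hi
    have := hsgn i (-1) (Or.inr hi) (fun h => absurd ⟨h, hi⟩ (hnd i)) (fun _ => by norm_num)
    linarith

lemma aux_lip_s13 {n m : ℕ} (c : (Fin n → ℝ) → (Fin m → ℝ)) (hc : ContDiff ℝ 2 c)
    (J : (Fin n → ℝ) → Matrix (Fin m) (Fin n) ℝ)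
    (hJ : ∀ y, HasFDerivAt c (LinearMap.toContinuousLinearMap (J y).mulVecLin) y)
    (x0 : Fin n → ℝ) :
    ∃ K ≥ (0:ℝ), ∃ ε > (0:ℝ), ∀ x, ‖x - x0‖ ≤ ε → ∀ j i, |J x j i - J x0 j i| ≤ K * ‖x - x0‖ := by
  have h1 : ContDiff ℝ 1 (fderiv ℝ c) := hc.fderiv_right (by norm_num)
  obtain ⟨K, s, hs, hK⟩ := (h1.contDiffAt (x := x0)).exists_lipschitzOnWith
  obtain ⟨ε, hε, hb⟩ := Metric.nhds_basis_closedBall.mem_iff.1 hs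
  refine ⟨K, K.2, ε, hε, fun x hx j i => ?_⟩
  have hxs : x ∈ s := hb (by simpa [dist_eq_norm] using hx)
  have hx0 : x0 ∈ s := mem_of_mem_nhds hs
  have h2 := hK.dist_le_mul x hxs x0 hx0
  rw [dist_eq_norm, dist_eq_norm] at h2
  have he : ∀ y, J y j i = fderiv ℝ c y (Pi.single i 1) j := by
    intro y
    rw [(hJ y).fderiv]
    simp
  rw [he, he]
  have h3 := (fderiv ℝ c x - fderiv ℝ c x0).le_opNorm (Pi.single i 1)
  have h4 : ‖(Pi.single i 1 : Fin n → ℝ)‖ = 1 := by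
    rw [Pi.norm_single]; simp
  rw [h4, mul_one] at h3
  have h5 := norm_le_pi_norm ((fderiv ℝ c x - fderiv ℝ c x0) (Pi.single i 1)) j
  rw [Real.norm_eq_abs] at h5
  simp only [_root_.sub_apply, Pi.sub_apply] at h5 h3
  linarith

lemma aux_E {n m t : ℕ} (A B : Fin n → Prop) (hAB : ∀ i, A i → B i)
    (hA : m + Set.ncard {i | A i} + t = n) (hB : m + Set.ncard {i | B i} = n) :
    ∃ E : Fin t → {i : Fin n // ¬ A i}, Function.Injective E ∧ ∀ i, B i → ¬ A i → ∃ k, (E k).1 = i := by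
  have hcard : Nat.card {i : Fin n // B i ∧ ¬ A i} = t := by
    have h1 : Set.ncard ({i | B i} \ {i | A i}) = Set.ncard {i | B i} - Set.ncard {i | A i} :=
      Set.ncard_sdiff (fun i hi => hAB i hi) (Set.toFinite _)
    have h2 : Nat.card {i : Fin n // B i ∧ ¬ A i} = Set.ncard ({i | B i} \ {i | A i}) := rfl
    omega
  have e : Fin t ≃ {i : Fin n // B i ∧ ¬ A i} := (Finite.equivFinOfCardEq hcard).symm
  refine ⟨fun k => ⟨(e k).1, (e k).2.2⟩, ?_, ?_⟩
  · intro a b h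
    apply e.injective
    simp only [Subtype.mk.injEq] at h
    exact Subtype.ext h
  · intro i hi hi'
    exact ⟨e.symm ⟨i, hi, hi'⟩, by simp⟩

/-- Lagrange multiplier estimation: if the LP subproblem at `x^k` has a nondegenerate
solution `(d^k, 0)` that identifies the optimal active set exactly, then (under the
regularity assumption on augmented Jacobians) the dual LP has a solution within
`O(‖x^k − x*‖)` of the optimal multipliers. -/
theorem slp_dual_multiplier_estimate
    (n m : ℕ) (hnm : m ≤ n)
    (p xlb xub : Fin n → ℝ)
    (c : (Fin n → ℝ) → (Fin m → ℝ)) (hc : ContDiff ℝ 2 c)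
    (J : (Fin n → ℝ) → Matrix (Fin m) (Fin n) ℝ)
    (hJ : ∀ y, HasFDerivAt c (LinearMap.toContinuousLinearMap (J y).mulVecLin) y)
    (ω : ℝ) (hω : 0 < ω)
    (xstar : Fin n → ℝ) (lamstar : Fin m → ℝ) (mustar nustar : Fin n → ℝ)
    -- KKT conditions of the penalized problem (CNSO)
    (hkkt_stat : p + ω • ((J xstar)ᵀ.mulVec lamstar) - mustar - nustar = 0)
    (hkkt_sub : ∀ j, (0 < c xstar j → lamstar j = 1) ∧ (c xstar j < 0 → lamstar j = -1) ∧
      (c xstar j = 0 → |lamstar j| ≤ 1))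
    (hkkt_lb : ∀ i, xlb i ≤ xstar i ∧ 0 ≤ mustar i ∧ (xstar i - xlb i) * mustar i = 0)
    (hkkt_ub : ∀ i, xstar i ≤ xub i ∧ nustar i ≤ 0 ∧ (xstar i - xub i) * nustar i = 0)
    -- LICQ at x*
    (hLICQ : LinearIndependent ℝ
      (Sum.elim (fun j : Fin m => (J xstar) j)
        (fun a : {i : Fin n // xstar i = xlb i ∨ xstar i = xub i} => Pi.single a.1 (1:ℝ))))
    -- the (under-)determination gap t = n − m − |A(x*)|
    (t : ℕ) (ht : m + Set.ncard {i | xstar i = xlb i ∨ xstar i = xub i} + t = n)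
    -- regularity assumption: every completion of [∇c(x*); I_{A*}] by coordinate rows from
    -- the inactive indices is nonsingular with inverse (operator norm) bounded by ξ
    (ξ : ℝ) (hξ : 0 < ξ)
    (hassum : ∀ E : Fin t → {i : Fin n // ¬(xstar i = xlb i ∨ xstar i = xub i)},
      Function.Injective E →
      ∃ Minv : Matrix (Fin n)
          ((Fin m ⊕ {i : Fin n // xstar i = xlb i ∨ xstar i = xub i}) ⊕ Fin t) ℝ,
        (Matrix.of (Sum.elim
            (Sum.elim (fun j : Fin m => (J xstar) j)
              (fun a : {i : Fin n // xstar i = xlb i ∨ xstar i = xub i} =>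
                Pi.single a.1 (1:ℝ)))
            (fun k : Fin t => Pi.single (E k).1 (1:ℝ)))) * Minv = 1 ∧
        Minv * (Matrix.of (Sum.elim
            (Sum.elim (fun j : Fin m => (J xstar) j)
              (fun a : {i : Fin n // xstar i = xlb i ∨ xstar i = xub i} =>
                Pi.single a.1 (1:ℝ)))
            (fun k : Fin t => Pi.single (E k).1 (1:ℝ)))) = 1 ∧
        ∀ v : (Fin m ⊕ {i : Fin n // xstar i = xlb i ∨ xstar i = xub i}) ⊕ Fin t → ℝ,
          ‖Minv.mulVec v‖ ≤ ξ * ‖v‖) :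
    ∃ ε > (0:ℝ), ∃ Mc > (0:ℝ),
      ∀ (xk : Fin n → ℝ) (Δk : ℝ) (dk : Fin n → ℝ), 0 < Δk →
      ∀ lk uk : Fin n → ℝ,
        lk = (fun i => max (xlb i - xk i) (-Δk)) →
        uk = (fun i => min (xub i - xk i) Δk) →
        -- (d^k, 0) is a feasible solution of the LP subproblem ...
        (∀ i, lk i ≤ dk i ∧ dk i ≤ uk i) →
        (∀ j, c xk j + (J xk).mulVec dk j = 0) →
        -- ... which is optimal ...
        (∀ (d' : Fin n → ℝ) (α' : Fin m → ℝ),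
          (∀ j, -α' j ≤ c xk j + (J xk).mulVec d' j ∧ c xk j + (J xk).mulVec d' j ≤ α' j) →
          (∀ i, lk i ≤ d' i ∧ d' i ≤ uk i) →
          p ⬝ᵥ dk ≤ p ⬝ᵥ d' + ω * ∑ j, α' j) →
        -- ... and nondegenerate (a basic solution with exactly n + m active constraints)
        (m + Set.ncard {i | dk i = lk i ∨ dk i = uk i} = n) →
        (∀ i, ¬(dk i = lk i ∧ dk i = uk i)) →
        LinearIndependent ℝ
          (Sum.elim (fun j : Fin m => (J xk) j)
            (fun a : {i : Fin n // dk i = lk i ∨ dk i = uk i} => Pi.single a.1 (1:ℝ))) →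
        -- x^k + d^k identifies the optimal active set exactly
        (∀ i, xk i + dk i = xlb i ↔ xstar i = xlb i) →
        (∀ i, xk i + dk i = xub i ↔ xstar i = xub i) →
        ‖xk - xstar‖ ≤ ε →
        -- conclusion: the dual LP has a solution close to the optimal multipliers
        ∃ (lamk : Fin m → ℝ) (muk nuk : Fin n → ℝ),
          (p + ω • ((J xk)ᵀ.mulVec lamk) - muk - nuk = 0) ∧
          (∀ j, |lamk j| ≤ 1) ∧ (∀ i, 0 ≤ muk i) ∧ (∀ i, nuk i ≤ 0) ∧
          (∀ (lam' : Fin m → ℝ) (mu' nu' : Fin n → ℝ),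
            (p + ω • ((J xk)ᵀ.mulVec lam') - mu' - nu' = 0) →
            (∀ j, |lam' j| ≤ 1) → (∀ i, 0 ≤ mu' i) → (∀ i, nu' i ≤ 0) →
            ω * (c xk ⬝ᵥ lam') + lk ⬝ᵥ mu' + uk ⬝ᵥ nu' ≤
              ω * (c xk ⬝ᵥ lamk) + lk ⬝ᵥ muk + uk ⬝ᵥ nuk) ∧
          ‖lamk - lamstar‖ ≤ Mc * ‖xk - xstar‖ ∧
          ‖muk - mustar‖ ≤ Mc * ‖xk - xstar‖ ∧
          ‖nuk - nustar‖ ≤ Mc * ‖xk - xstar‖ := by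
  obtain ⟨K, hK0, ε, hε, hLip⟩ := aux_lip_s13 c hc J hJ xstar
  obtain ⟨G, hG0, hG⟩ : ∃ G ≥ (0:ℝ), ∀ j i, |J xstar j i| ≤ G := by
    refine ⟨∑ j, ∑ i, |J xstar j i|, by positivity, fun j i => ?_⟩
    calc |J xstar j i| ≤ ∑ i, |J xstar j i| :=
          Finset.single_le_sum (f := fun i => |J xstar j i|) (fun _ _ => abs_nonneg _) (Finset.mem_univ i)
      _ ≤ _ := Finset.single_le_sum (f := fun j => ∑ i, |J xstar j i|)
          (fun _ _ => Finset.sum_nonneg fun _ _ => abs_nonneg _) (Finset.mem_univ j)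
  set C1 : ℝ := n * ξ * m * K with hC1
  set C2 : ℝ := ω * m * G * C1 + ω * m * K with hC2
  have hC10 : 0 ≤ C1 := by positivity
  have hC20 : 0 ≤ C2 := by positivity
  refine ⟨ε, hε, C1 + C2 + 1, by positivity, ?_⟩
  intro xk Δk dk hΔ lk uk hlk huk hd hfeas hopt hcard hnd hLI hidl hidu hx
  obtain ⟨lam, y, hy, hlam1, hyl, hyu, hy0⟩ :=
    aux_dual (J xk) (c xk) p lk uk dk ω hω hd hfeas hopt hcard hnd hLI
  have hlA : ∀ i, xstar i = xlb i → dk i = lk i := by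
    intro i hi
    have h1 := (hidl i).2 hi
    have h2 := (hd i).1
    have h3 : xlb i - xk i ≤ lk i := by rw [hlk]; exact le_max_left _ _
    linarith
  have huA : ∀ i, xstar i = xub i → dk i = uk i := by
    intro i hi
    have h1 := (hidu i).2 hi
    have h2 := (hd i).2
    have h3 : uk i ≤ xub i - xk i := by rw [huk]; exact min_le_left _ _
    linarith
  obtain ⟨E, hEinj, hEB⟩ := aux_E (fun i => xstar i = xlb i ∨ xstar i = xub i)
    (fun i => dk i = lk i ∨ dk i = uk i) (fun i hi => hi.imp (hlA i) (huA i)) ht hcard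
  obtain ⟨Minv, hM1, -, hMb⟩ := hassum E hEinj
  -- test vectors
  have hw : ∀ j : Fin m, ∃ w : Fin n → ℝ, ‖w‖ ≤ ξ ∧ (J xstar).mulVec w = Pi.single j 1 ∧
      ∀ i, (dk i = lk i ∨ dk i = uk i) → w i = 0 := by
    intro j
    set w := Minv.mulVec (Pi.single (Sum.inl (Sum.inl j)) 1) with hwdef
    have hMw := congrArg (fun M => M.mulVec (Pi.single (Sum.inl (Sum.inl j)) (1:ℝ))) hM1
    simp only [← Matrix.mulVec_mulVec, Matrix.one_mulVec] at hMw
    rw [← hwdef] at hMw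
    refine ⟨w, ?_, ?_, ?_⟩
    · have := hMb (Pi.single (Sum.inl (Sum.inl j)) 1)
      rw [Pi.norm_single, norm_one, mul_one] at this
      exact this
    · ext j'
      have h := congrFun hMw (Sum.inl (Sum.inl j'))
      simp only [Matrix.mulVec, Matrix.of_apply, Sum.elim_inl] at h ⊢
      rw [h]
      simp [Pi.single_apply]
    · intro i hi
      by_cases hA : xstar i = xlb i ∨ xstar i = xub i
      · have h := congrFun hMw (Sum.inl (Sum.inr ⟨i, hA⟩))
        simpa [Matrix.mulVec] using h
      · obtain ⟨k, hk⟩ := hEB i hi hA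
        have h := congrFun hMw (Sum.inr k)
        simp [Matrix.mulVec] at h
        rw [hk] at h
        exact h
  set D := ‖xk - xstar‖ with hD
  have hD0 : 0 ≤ D := norm_nonneg _
  set ys : Fin n → ℝ := p + ω • ((J xstar)ᵀ.mulVec lamstar) with hys
  have hys' : ∀ i, ys i = mustar i + nustar i := by
    intro i
    have := congrFun hkkt_stat i
    simp only [Pi.sub_apply, Pi.zero_apply] at this
    linarith
  have hmu0 : ∀ i, xstar i ≠ xlb i → mustar i = 0 := fun i hi =>
    (mul_eq_zero.1 (hkkt_lb i).2.2).resolve_left (sub_ne_zero.2 hi)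
  have hnu0 : ∀ i, xstar i ≠ xub i → nustar i = 0 := fun i hi =>
    (mul_eq_zero.1 (hkkt_ub i).2.2).resolve_left (sub_ne_zero.2 hi)
  have hsplit : ∀ i, mustar i = max (ys i) 0 ∧ nustar i = min (ys i) 0 := by
    intro i
    rw [hys' i]
    have hm := (hkkt_lb i).2.1
    have hn := (hkkt_ub i).2.1
    by_cases hl : xstar i = xlb i
    · have hu : xstar i ≠ xub i := fun hu => hnd i ⟨hlA i hl, huA i hu⟩
      rw [hnu0 i hu, add_zero]
      exact ⟨(max_eq_left hm).symm, (min_eq_right hm).symm⟩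
    · rw [hmu0 i hl, zero_add]
      exact ⟨(max_eq_right hn).symm, (min_eq_left hn).symm⟩
  have hys0 : ∀ i, ¬ (dk i = lk i ∨ dk i = uk i) → ys i = 0 := by
    intro i hi
    rw [hys' i, hmu0 i (fun h => hi (Or.inl (hlA i h))), hnu0 i (fun h => hi (Or.inr (huA i h))),
      add_zero]
  -- residual
  set r : Fin n → ℝ := fun i => ω * ∑ j, (J xk j i - J xstar j i) * lam j with hr
  have hrb : ∀ i, |r i| ≤ ω * m * K * D := by
    intro i
    have h1 : |∑ j, (J xk j i - J xstar j i) * lam j| ≤ ∑ _j : Fin m, K * D := by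
      refine (Finset.abs_sum_le_sum_abs _ _).trans (Finset.sum_le_sum fun j _ => ?_)
      rw [abs_mul]
      calc _ ≤ (K * D) * 1 := mul_le_mul (hLip xk hx j i) (hlam1 j) (abs_nonneg _) (by positivity)
        _ = _ := mul_one _
    rw [Finset.sum_const, Finset.card_univ, Fintype.card_fin, nsmul_eq_mul] at h1
    rw [hr, abs_mul, abs_of_pos hω]
    have := mul_le_mul_of_nonneg_left h1 hω.le
    linarith
  have hδ : y - ys = ω • ((J xstar)ᵀ.mulVec (lam - lamstar)) + r := by
    ext i
    simp only [hy, hys, hr, Pi.sub_apply, Pi.add_apply, Pi.smul_apply, smul_eq_mul, Matrix.mulVec,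
      dotProduct, Matrix.transpose_apply, sub_mul, mul_sub, Finset.sum_sub_distrib]
    ring
  have hη : ∀ j, |lam j - lamstar j| ≤ C1 * D := by
    intro j
    obtain ⟨w, hwn, hwJ, hwB⟩ := hw j
    have h0 : (y - ys) ⬝ᵥ w = 0 := by
      apply Finset.sum_eq_zero
      intro i _
      by_cases hi : dk i = lk i ∨ dk i = uk i
      · rw [hwB i hi, mul_zero]
      · rw [Pi.sub_apply, hy0 i hi, hys0 i hi]; simp
    rw [hδ, add_dotProduct, smul_dotProduct, smul_eq_mul, Matrix.mulVec_transpose,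
      ← Matrix.dotProduct_mulVec, hwJ, dotProduct_single, mul_one, Pi.sub_apply] at h0
    have h1 : |r ⬝ᵥ w| ≤ ∑ _i : Fin n, (ω * m * K * D) * ξ := by
      refine (Finset.abs_sum_le_sum_abs _ _).trans (Finset.sum_le_sum fun i _ => ?_)
      rw [abs_mul]
      exact mul_le_mul (hrb i) ((norm_le_pi_norm w i).trans hwn) (abs_nonneg _) (by positivity)
    rw [Finset.sum_const, Finset.card_univ, Fintype.card_fin, nsmul_eq_mul] at h1
    have h2 : ω * |lam j - lamstar j| = |r ⬝ᵥ w| := by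
      rw [← abs_of_pos hω, ← abs_mul, eq_neg_of_add_eq_zero_left h0, abs_neg]
    have h3 : ω * |lam j - lamstar j| ≤ ω * (C1 * D) := by
      rw [h2]; refine h1.trans (le_of_eq ?_); rw [hC1]; ring
    exact le_of_mul_le_mul_left h3 hω
  have hyb : ∀ i, |y i - ys i| ≤ C2 * D := by
    intro i
    have h := congrFun hδ i
    simp only [Pi.sub_apply, Pi.add_apply, Pi.smul_apply, smul_eq_mul] at h
    rw [h]
    have h1 : |((J xstar)ᵀ.mulVec (lam - lamstar)) i| ≤ ∑ _j : Fin m, G * (C1 * D) := by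
      simp only [Matrix.mulVec, dotProduct, Matrix.transpose_apply]
      refine (Finset.abs_sum_le_sum_abs _ _).trans (Finset.sum_le_sum fun j _ => ?_)
      rw [abs_mul]
      exact mul_le_mul (hG j i) (hη j) (abs_nonneg _) hG0
    rw [Finset.sum_const, Finset.card_univ, Fintype.card_fin, nsmul_eq_mul] at h1
    refine (abs_add_le _ _).trans ?_
    rw [abs_mul, abs_of_pos hω]
    have h2 := mul_le_mul_of_nonneg_left h1 hω.le
    have h3 := hrb i
    have h4 : C2 * D = ω * (m * (G * (C1 * D))) + ω * m * K * D := by rw [hC2]; ring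
    linarith
  have hMc1 : C1 * D ≤ (C1 + C2 + 1) * D := by gcongr; linarith
  have hMc2 : C2 * D ≤ (C1 + C2 + 1) * D := by gcongr; linarith
  have hMc0 : 0 ≤ (C1 + C2 + 1) * D := by positivity
  have hmn : ∀ i, max (y i) 0 + min (y i) 0 = y i := fun i => by
    rw [max_add_min, add_zero]
  -- dual value
  have hval : ∀ (lam' : Fin m → ℝ) (mu' nu' : Fin n → ℝ),
      (p + ω • ((J xk)ᵀ.mulVec lam') - mu' - nu' = 0) →
      ω * (c xk ⬝ᵥ lam') + lk ⬝ᵥ mu' + uk ⬝ᵥ nu' =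
        p ⬝ᵥ dk + ∑ i, ((lk i - dk i) * mu' i + (uk i - dk i) * nu' i) := by
    intro lam' mu' nu' h
    have h1 : c xk = -((J xk).mulVec dk) := by
      ext j; have := hfeas j; simp only [Pi.neg_apply]; linarith
    have h2 : p + ω • ((J xk)ᵀ.mulVec lam') = mu' + nu' := by
      rw [sub_sub, sub_eq_zero] at h; exact h
    have h3 := congrArg (fun z => z ⬝ᵥ dk) h2
    simp only [add_dotProduct, smul_dotProduct, smul_eq_mul, Matrix.mulVec_transpose,
      ← Matrix.dotProduct_mulVec] at h3
    have h4 : ∑ i, ((lk i - dk i) * mu' i + (uk i - dk i) * nu' i) =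
        lk ⬝ᵥ mu' + uk ⬝ᵥ nu' - (mu' ⬝ᵥ dk + nu' ⬝ᵥ dk) := by
      simp only [dotProduct, ← Finset.sum_add_distrib, ← Finset.sum_sub_distrib]
      exact Finset.sum_congr rfl fun i _ => by ring
    rw [h4, h1, neg_dotProduct, dotProduct_comm ((J xk).mulVec dk) lam']
    linarith
  have hstat : p + ω • ((J xk)ᵀ.mulVec lam) - (fun i => max (y i) 0) - (fun i => min (y i) 0) = 0 := by
    rw [← hy]
    ext i
    simp only [Pi.sub_apply, Pi.zero_apply]
    linarith [hmn i]
  refine ⟨lam, fun i => max (y i) 0, fun i => min (y i) 0, hstat, hlam1,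
    fun i => le_max_right _ _, fun i => min_le_right _ _, ?_, ?_, ?_, ?_⟩
  · intro lam' mu' nu' h1 _ h3 h4
    rw [hval _ _ _ h1, hval _ _ _ hstat]
    refine add_le_add le_rfl ?_
    apply Finset.sum_le_sum
    intro i _
    have e1 : (lk i - dk i) * max (y i) 0 = 0 := by
      by_cases h : dk i = lk i
      · rw [h, sub_self, zero_mul]
      · have : y i ≤ 0 := by
          by_cases h' : dk i = uk i
          · exact hyu i h'
          · exact (hy0 i (by tauto)).le
        rw [max_eq_right this, mul_zero]
    have e2 : (uk i - dk i) * min (y i) 0 = 0 := by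
      by_cases h : dk i = uk i
      · rw [h, sub_self, zero_mul]
      · have : 0 ≤ y i := by
          by_cases h' : dk i = lk i
          · exact hyl i h'
          · exact (hy0 i (by tauto)).ge
        rw [min_eq_right this, mul_zero]
    have e3 := mul_nonneg (sub_nonneg.2 (hd i).1) (h3 i)
    have e4 := mul_nonneg (sub_nonneg.2 (hd i).2) (neg_nonneg.2 (h4 i))
    rw [e1, e2]
    linarith
  · rw [pi_norm_le_iff_of_nonneg hMc0]
    intro j
    exact (hη j).trans hMc1
  · rw [pi_norm_le_iff_of_nonneg hMc0]
    intro i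
    rw [Pi.sub_apply, (hsplit i).1, Real.norm_eq_abs]
    exact ((abs_max_sub_max_le_abs _ _ _).trans (hyb i)).trans hMc2
  · rw [pi_norm_le_iff_of_nonneg hMc0]
    intro i
    rw [Pi.sub_apply, (hsplit i).2, Real.norm_eq_abs]
    have := abs_min_sub_min_le_max (y i) 0 (ys i) 0
    rw [sub_self, abs_zero, max_eq_left (abs_nonneg _)] at this
    exact (this.trans (hyb i)).trans hMc2
end
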